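/- arXiv:1708.01832 — 2 statements merged into one kernel-verified Lean document; each statement's English description precedes it below -/
import Mathlib

section
/- For each M ∈ [0,∞), the sub-level set Γ_M := {(ζ, ψ) ∈ C([0,T], ℝ^∞) × C([0,T], ℝ) : I_T(ζ, ψ) ≤ M} is a compact subset of C([0,T], ℝ^∞) × C([0,T], ℝ) with the uniform (product) topology; in particular I_T is a rate function. -/
open MeasureTheory Filter Topology
open scoped ENNReal

noncomputable def ell (x : ℝ) : ℝ := x * Real.log x - x + 1

noncomputable def rtot (x : ℕ → ℝ) : ℝ := max (x 0) 0 + ∑' k : ℕ, (k : ℝ) * x k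

noncomputable def rcoord (x : ℕ → ℝ) (k : ℕ) : ℝ :=
  if 0 < rtot x then (if k = 0 then max (x 0) 0 else (k : ℝ) * x k) / rtot x else 0

noncomputable def skorokhod (ψ : ℝ → ℝ) (t : ℝ) : ℝ :=
  ψ t - min (sInf (ψ '' Set.Icc 0 t)) 0

def AbsCont (f : ℝ → ℝ) (a b : ℝ) : Prop :=
  ∀ ε > 0, ∃ δ > 0, ∀ n : ℕ, ∀ I : Fin n → ℝ × ℝ,
    (∀ i, (I i).1 ∈ Set.Icc a b ∧ (I i).2 ∈ Set.Icc a b ∧ (I i).1 ≤ (I i).2) →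
    (∀ i j, i ≠ j → Disjoint (Set.Ioo (I i).1 (I i).2) (Set.Ioo (I j).1 (I j).2)) →
    (∑ i, ((I i).2 - (I i).1)) < δ →
    (∑ i, |f (I i).2 - f (I i).1|) < ε

def memCT (T : ℝ) (p : ℕ → ℝ) (ζ : ℕ → ℝ → ℝ) (ψ : ℝ → ℝ) : Prop :=
  (∀ k, ContinuousOn (ζ k) (Set.Icc 0 T)) ∧
  ContinuousOn ψ (Set.Icc 0 T) ∧
  ψ 0 = 0 ∧ AbsCont ψ 0 T ∧
  (∀ t ∈ Set.Icc (0:ℝ) T, ζ 0 t = skorokhod ψ t) ∧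
  (∀ k : ℕ, 1 ≤ k →
    ζ k 0 = p k ∧ (∀ t ∈ Set.Icc (0:ℝ) T, 0 ≤ ζ k t) ∧
    AntitoneOn (ζ k) (Set.Icc 0 T) ∧ AbsCont (ζ k) 0 T)

noncomputable def Bint (ζ : ℕ → ℝ → ℝ) (φ : ℕ → ℝ → ℝ → ℝ) (k : ℕ) (t : ℝ) : ℝ :=
  ∫ q in (Set.Icc (0:ℝ) t) ×ˢ (Set.Icc (0:ℝ) 1),
    (if 0 ≤ q.2 ∧ q.2 < rcoord (fun j => ζ j q.1) k then φ k q.1 q.2 else 0)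

def memST (T : ℝ) (p : ℕ → ℝ) (ζ : ℕ → ℝ → ℝ) (ψ : ℝ → ℝ) (φ : ℕ → ℝ → ℝ → ℝ) : Prop :=
  (∀ k, Measurable (fun q : ℝ × ℝ => φ k q.1 q.2)) ∧
  (∀ k s y, 0 ≤ φ k s y) ∧
  (∀ k, IntegrableOn
      (fun q : ℝ × ℝ => if 0 ≤ q.2 ∧ q.2 < rcoord (fun j => ζ j q.1) k then φ k q.1 q.2 else 0)
      ((Set.Icc (0:ℝ) T) ×ˢ (Set.Icc (0:ℝ) 1))) ∧
  (∀ t ∈ Set.Icc (0:ℝ) T, ψ t = ∑' k : ℕ, ((k : ℝ) - 2) * Bint ζ φ k t) ∧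
  (∀ t ∈ Set.Icc (0:ℝ) T, ∀ k : ℕ, 1 ≤ k → ζ k t = p k - Bint ζ φ k t)

noncomputable def costE (T : ℝ) (φ : ℕ → ℝ → ℝ → ℝ) : ℝ≥0∞ :=
  ∑' k : ℕ, ∫⁻ q in (Set.Icc (0:ℝ) T) ×ˢ (Set.Icc (0:ℝ) 1),
    ENNReal.ofReal (ell (φ k q.1 q.2))

open Classical in
noncomputable def rateI (T : ℝ) (p : ℕ → ℝ) (ζ : ℕ → ℝ → ℝ) (ψ : ℝ → ℝ) : ℝ≥0∞ :=
  if memCT T p ζ ψ then ⨅ (φ : ℕ → ℝ → ℝ → ℝ) (_ : memST T p ζ ψ φ), costE T φ else ⊤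

/-! ### The entropy function and its perspective -/

lemma continuous_ell : Continuous ell := by
  unfold ell
  exact (Real.continuous_mul_log.sub continuous_id).add continuous_const

lemma ell_tangent_le {x c : ℝ} (hx : 0 ≤ x) (hc : 0 < c) :
    1 - c + x * Real.log c ≤ ell x := by
  unfold ell
  rcases hx.eq_or_lt with rfl | hx
  · simp; linarith
  · have h := Real.log_le_sub_one_of_pos (div_pos hc hx)
    rw [Real.log_div hc.ne' hx.ne'] at h
    have h2 := mul_le_mul_of_nonneg_left h hx.le
    have h3 : x * (c / x - 1) = c - x := by field_simp
    nlinarith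

lemma ell_nonneg {x : ℝ} (hx : 0 ≤ x) : 0 ≤ ell x := by
  simpa using ell_tangent_le hx one_pos

lemma ell_zero : ell 0 = 1 := by simp [ell]

lemma ell_one : ell 1 = 0 := by simp [ell]

/-- The cost density of a total flux `g` through an interval of length `r`. -/
noncomputable def perspCost (r g : ℝ) : ℝ := r * ell (g / r)

lemma perspCost_tangent_le {r g c : ℝ} (hr : 0 ≤ r) (hg : 0 ≤ g) (h : r = 0 → g = 0)
    (hc : 0 < c) : r * (1 - c) + g * Real.log c ≤ perspCost r g := by
  unfold perspCost
  rcases hr.eq_or_lt with h0 | hr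
  · simp [h h0.symm, h0.symm]
  · have := mul_le_mul_of_nonneg_left (ell_tangent_le (div_nonneg hg hr.le) hc) hr.le
    calc _ = r * (1 - c + g / r * Real.log c) := by field_simp
      _ ≤ _ := this

lemma perspCost_le_of_tangent {r g : ℝ} {X : ℝ≥0∞} (hr : 0 ≤ r) (hg : 0 ≤ g)
    (h : ∀ c : ℝ, 0 < c → ENNReal.ofReal (r * (1 - c) + g * Real.log c) ≤ X) :
    ENNReal.ofReal (perspCost r g) ≤ X := by
  rcases hr.eq_or_lt with rfl | hr
  · simp [perspCost]
  rcases hg.eq_or_lt with rfl | hg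
  · have h1 : Tendsto (fun c : ℝ => ENNReal.ofReal (r * (1 - c) + 0 * Real.log c)) (𝓝[>] 0)
        (𝓝 (ENNReal.ofReal (r * (1 - 0)))) := by
      refine (ENNReal.continuous_ofReal.tendsto _).comp ?_
      have : Continuous fun c : ℝ => r * (1 - c) + 0 * Real.log c := by
        simp only [zero_mul, add_zero]; fun_prop
      simpa using (this.tendsto 0).mono_left nhdsWithin_le_nhds
    have h2 := le_of_tendsto h1 (eventually_nhdsWithin_of_forall fun c hc => h c hc)
    simpa [perspCost, ell_zero] using h2
  · refine le_of_eq_of_le ?_ (h (g / r) (div_pos hg hr))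
    congr 1
    unfold perspCost ell
    field_simp
    ring

/-! ### Regularity of paths and of the size-biased coordinates -/

/-- Continuous paths with `0 ≤ ζ₀` and `0 ≤ ζₖ ≤ pₖ` for `k ≥ 1`. -/
structure PathReg (p : ℕ → ℝ) (ζ : ℕ → ℝ → ℝ) : Prop where
  cont : ∀ k, Continuous (ζ k)
  nonneg : ∀ k s, 0 ≤ ζ k s
  le : ∀ k, 1 ≤ k → ∀ s, ζ k s ≤ p k

section PathReg

variable {p : ℕ → ℝ} {ζ : ℕ → ℝ → ℝ}

lemma PathReg.mul_le (h : PathReg p ζ) (k : ℕ) (s : ℝ) : (k : ℝ) * ζ k s ≤ k * p k := by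
  rcases Nat.eq_zero_or_pos k with rfl | hk
  · simp
  · exact mul_le_mul_of_nonneg_left (h.le k hk s) k.cast_nonneg

lemma PathReg.norm_mul_le (h : PathReg p ζ) (k : ℕ) (s : ℝ) : ‖(k : ℝ) * ζ k s‖ ≤ k * p k := by
  rw [Real.norm_of_nonneg (mul_nonneg k.cast_nonneg (h.nonneg k s))]
  exact h.mul_le k s

lemma PathReg.summable (h : PathReg p ζ) (hp : Summable fun k : ℕ => (k : ℝ) * p k) (s : ℝ) :
    Summable fun k : ℕ => (k : ℝ) * ζ k s :=
  Summable.of_norm_bounded hp fun k => h.norm_mul_le k s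

lemma PathReg.continuous_rtot (h : PathReg p ζ) (hp : Summable fun k : ℕ => (k : ℝ) * p k) :
    Continuous fun s => rtot fun j => ζ j s := by
  unfold rtot
  refine ((h.cont 0).max continuous_const).add ?_
  exact continuous_tsum (fun k => continuous_const.mul (h.cont k)) hp fun k s => h.norm_mul_le k s

lemma PathReg.rtot_nonneg (h : PathReg p ζ) (s : ℝ) : 0 ≤ rtot fun j => ζ j s :=
  add_nonneg (le_max_right _ _) (tsum_nonneg fun k => mul_nonneg k.cast_nonneg (h.nonneg k s))

lemma PathReg.measurable_rcoord (h : PathReg p ζ) (hp : Summable fun k : ℕ => (k : ℝ) * p k)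
    (k : ℕ) : Measurable fun s => rcoord (fun j => ζ j s) k := by
  unfold rcoord
  refine Measurable.ite (measurableSet_lt measurable_const (h.continuous_rtot hp).measurable) ?_
    measurable_const
  refine Measurable.div ?_ (h.continuous_rtot hp).measurable
  by_cases hk : k = 0
  · simpa [hk] using ((h.cont 0).max continuous_const).measurable
  · simpa [hk] using ((h.cont k).measurable).const_mul (k : ℝ)

lemma PathReg.rcoord_nonneg (h : PathReg p ζ) (s : ℝ) (k : ℕ) :
    0 ≤ rcoord (fun j => ζ j s) k := by
  unfold rcoord
  split_ifs
  · exact div_nonneg (le_max_right _ _) (h.rtot_nonneg s)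
  · exact div_nonneg (mul_nonneg k.cast_nonneg (h.nonneg k s)) (h.rtot_nonneg s)
  · exact le_rfl

lemma PathReg.mul_le_rtot (h : PathReg p ζ) (hp : Summable fun k : ℕ => (k : ℝ) * p k)
    (s : ℝ) (k : ℕ) : (k : ℝ) * ζ k s ≤ rtot fun j => ζ j s := by
  have := (h.summable hp s).le_tsum k fun j _ => mul_nonneg j.cast_nonneg (h.nonneg j s)
  exact this.trans (le_add_of_nonneg_left (le_max_right _ _))

lemma PathReg.coord_zero_le_rtot (h : PathReg p ζ) (s : ℝ) :
    ζ 0 s ≤ rtot fun j => ζ j s :=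
  (le_max_left _ _).trans
    (le_add_of_nonneg_right (tsum_nonneg fun k => mul_nonneg k.cast_nonneg (h.nonneg k s)))

lemma PathReg.rcoord_le_one (h : PathReg p ζ) (hp : Summable fun k : ℕ => (k : ℝ) * p k)
    (s : ℝ) (k : ℕ) : rcoord (fun j => ζ j s) k ≤ 1 := by
  unfold rcoord
  split_ifs with h0 h1
  · refine div_le_one_of_le₀ ?_ (h.rtot_nonneg s)
    rw [max_eq_left (h.nonneg 0 s)]
    exact h.coord_zero_le_rtot s
  · exact div_le_one_of_le₀ (h.mul_le_rtot hp s k) (h.rtot_nonneg s)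
  · exact zero_le_one

lemma rcoord_zero_of_nonpos {x : ℕ → ℝ} (hx : x 0 ≤ 0) : rcoord x 0 = 0 := by
  simp [rcoord, max_eq_right hx]

lemma PathReg.tendsto_rtot {ζs : ℕ → ℕ → ℝ → ℝ} (hs : ∀ n, PathReg p (ζs n))
    (hp : Summable fun k : ℕ => (k : ℝ) * p k) {s : ℝ}
    (hlim : ∀ k, Tendsto (fun n => ζs n k s) atTop (𝓝 (ζ k s))) :
    Tendsto (fun n => rtot fun j => ζs n j s) atTop (𝓝 (rtot fun j => ζ j s)) := by
  unfold rtot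
  refine ((hlim 0).max tendsto_const_nhds).add ?_
  exact tendsto_tsum_of_dominated_convergence hp (fun k => (hlim k).const_mul (k : ℝ))
    (Eventually.of_forall fun n k => (hs n).norm_mul_le k s)

lemma PathReg.tendsto_rcoord {ζs : ℕ → ℕ → ℝ → ℝ} (hs : ∀ n, PathReg p (ζs n))
    (hp : Summable fun k : ℕ => (k : ℝ) * p k) {s : ℝ}
    (hlim : ∀ k, Tendsto (fun n => ζs n k s) atTop (𝓝 (ζ k s)))
    (hpos : 0 < rtot fun j => ζ j s) (k : ℕ) :
    Tendsto (fun n => rcoord (fun j => ζs n j s) k) atTop (𝓝 (rcoord (fun j => ζ j s) k)) := by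
  have ht := PathReg.tendsto_rtot hs hp hlim
  have hev : ∀ᶠ n in atTop, 0 < rtot fun j => ζs n j s := ht.eventually (lt_mem_nhds hpos)
  unfold rcoord
  rw [if_pos hpos]
  refine Tendsto.congr' (hev.mono fun n hn => (if_pos hn).symm) ?_
  refine Tendsto.div ?_ ht hpos.ne'
  by_cases hk : k = 0
  · simpa [hk] using (hlim 0).max tendsto_const_nhds
  · simpa [hk] using (hlim k).const_mul (k : ℝ)

end PathReg

/-! ### Flux densities -/

/-- `g k` is the density in time of the `k`-th flux driving the path `(ζ, ψ)`. -/
structure IsFlux (T : ℝ) (p : ℕ → ℝ) (ζ : ℕ → ℝ → ℝ) (ψ : ℝ → ℝ) (g : ℕ → ℝ → ℝ) : Prop where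
  meas : ∀ k, Measurable (g k)
  nonneg : ∀ k s, 0 ≤ g k s
  int : ∀ k, IntegrableOn (g k) (Set.Icc 0 T)
  vanish : ∀ k, ∀ᵐ s ∂volume.restrict (Set.Icc 0 T), rcoord (fun j => ζ j s) k = 0 → g k s = 0
  psi : ∀ t ∈ Set.Icc (0 : ℝ) T,
    ψ t = ∑' k : ℕ, ((k : ℝ) - 2) * ∫ s in Set.Icc 0 t, g k s
  zeta : ∀ t ∈ Set.Icc (0 : ℝ) T, ∀ k : ℕ, 1 ≤ k → ζ k t = p k - ∫ s in Set.Icc 0 t, g k s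

/-- The cost of the `k`-th flux. -/
noncomputable def fluxCost (T : ℝ) (ζ : ℕ → ℝ → ℝ) (g : ℕ → ℝ → ℝ) (k : ℕ) : ℝ≥0∞ :=
  ∫⁻ s in Set.Icc 0 T, ENNReal.ofReal (perspCost (rcoord (fun j => ζ j s) k) (g k s))

lemma ofReal_integral_le_lintegral_ofReal {α : Type*} [MeasurableSpace α] {μ : Measure α}
    {f : α → ℝ} (hf : Integrable f μ) :
    ENNReal.ofReal (∫ x, f x ∂μ) ≤ ∫⁻ x, ENNReal.ofReal (f x) ∂μ := by
  rw [integral_eq_lintegral_pos_part_sub_lintegral_neg_part hf]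
  calc _ ≤ ENNReal.ofReal (∫⁻ x, ENNReal.ofReal (f x) ∂μ).toReal :=
        ENNReal.ofReal_le_ofReal (sub_le_self _ ENNReal.toReal_nonneg)
    _ ≤ _ := ENNReal.ofReal_toReal_le

/-- Jensen's inequality for the entropy function on an interval. -/
lemma perspCost_integral_le {r : ℝ} (hr : 0 ≤ r) (hr1 : r ≤ 1) {φ : ℝ → ℝ}
    (hφ : ∀ y, 0 ≤ φ y)
    (hInt : IntegrableOn (fun y => if 0 ≤ y ∧ y < r then φ y else 0) (Set.Icc 0 1)) :
    ENNReal.ofReal (perspCost r (∫ y in Set.Icc 0 1, if 0 ≤ y ∧ y < r then φ y else 0)) ≤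
      ∫⁻ y in Set.Icc 0 1, ENNReal.ofReal (ell (φ y)) := by
  refine perspCost_le_of_tangent hr ?_ fun c hc => ?_
  · exact integral_nonneg fun y => by dsimp only; split_ifs <;> simp [hφ]
  have h1 : ∫ y in Set.Icc (0 : ℝ) 1, (if 0 ≤ y ∧ y < r then (1 : ℝ) else 0) = r := by
    have : (fun y : ℝ => if 0 ≤ y ∧ y < r then (1 : ℝ) else 0) =
        (Set.Ico 0 r).indicator fun _ => 1 := by
      ext y; simp [Set.indicator_apply]
    rw [this, setIntegral_indicator measurableSet_Ico,
      Set.inter_eq_right.2 (Set.Ico_subset_Icc_self.trans (Set.Icc_subset_Icc_right hr1))]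
    simp [hr]
  have hi1 : IntegrableOn (fun y : ℝ => if 0 ≤ y ∧ y < r then (1 : ℝ) else 0) (Set.Icc 0 1) := by
    by_cases h0 : r = 0
    · subst h0
      have : (fun y : ℝ => if 0 ≤ y ∧ y < 0 then (1 : ℝ) else 0) = fun _ => 0 := by
        ext y; rw [if_neg]; intro h; linarith [h.1, h.2]
      rw [this]; exact integrableOn_zero
    · by_contra hcon
      exact h0 (h1.symm.trans (integral_undef hcon))
  have h2 : ∫ y in Set.Icc (0 : ℝ) 1, ((if 0 ≤ y ∧ y < r then (1 : ℝ) else 0) * (1 - c) +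
      (if 0 ≤ y ∧ y < r then φ y else 0) * Real.log c) =
      r * (1 - c) + (∫ y in Set.Icc 0 1, if 0 ≤ y ∧ y < r then φ y else 0) * Real.log c := by
    rw [integral_add (hi1.mul_const _) (hInt.mul_const _), integral_mul_const, integral_mul_const,
      h1]
  rw [← h2]
  refine (ofReal_integral_le_lintegral_ofReal ((hi1.mul_const _).add (hInt.mul_const _))).trans ?_
  refine lintegral_mono fun y => ENNReal.ofReal_le_ofReal ?_
  dsimp only [Pi.add_apply]
  split_ifs
  · simpa using ell_tangent_le (hφ y) hc
  · simpa using ell_nonneg (hφ y)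

lemma restrict_prod_Icc (t : ℝ) :
    (volume : Measure (ℝ × ℝ)).restrict (Set.Icc 0 t ×ˢ Set.Icc 0 1) =
      (volume.restrict (Set.Icc (0 : ℝ) t)).prod (volume.restrict (Set.Icc (0 : ℝ) 1)) := by
  rw [Measure.volume_eq_prod, Measure.prod_restrict]

section

variable {T : ℝ} {p : ℕ → ℝ} {ζ : ℕ → ℝ → ℝ} {ψ : ℝ → ℝ}

lemma PathReg.measurableSet_lt_rcoord (h : PathReg p ζ)
    (hp : Summable fun k : ℕ => (k : ℝ) * p k) (k : ℕ) :
    MeasurableSet {q : ℝ × ℝ | 0 ≤ q.2 ∧ q.2 < rcoord (fun j => ζ j q.1) k} :=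
  (measurableSet_le measurable_const measurable_snd).inter
    (measurableSet_lt measurable_snd ((h.measurable_rcoord hp k).comp measurable_fst))

/-- A control produces a flux whose cost is no larger. -/
lemma exists_isFlux_of_memST (h : PathReg p ζ) (hp : Summable fun k : ℕ => (k : ℝ) * p k)
    {φ : ℕ → ℝ → ℝ → ℝ} (hφ : memST T p ζ ψ φ) :
    ∃ g, IsFlux T p ζ ψ g ∧ ∑' k, fluxCost T ζ g k ≤ costE T φ := by
  obtain ⟨hm, hnn, hInt, hpsi, hzeta⟩ := hφ
  set F : ℕ → ℝ × ℝ → ℝ := fun k q =>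
    if 0 ≤ q.2 ∧ q.2 < rcoord (fun j => ζ j q.1) k then φ k q.1 q.2 else 0 with hF
  have hFm : ∀ k, Measurable (F k) := fun k =>
    Measurable.ite (h.measurableSet_lt_rcoord hp k) (hm k) measurable_const
  have hFnn : ∀ k q, 0 ≤ F k q := fun k q => by simp only [hF]; split_ifs <;> simp [hnn]
  have hFi : ∀ k, Integrable (F k) ((volume.restrict (Set.Icc (0 : ℝ) T)).prod
      (volume.restrict (Set.Icc (0 : ℝ) 1))) := fun k => by
    have := hInt k
    rwa [IntegrableOn, restrict_prod_Icc] at this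
  have hB : ∀ t ∈ Set.Icc (0 : ℝ) T, ∀ k,
      Bint ζ φ k t = ∫ s in Set.Icc 0 t, ∫ y in Set.Icc (0 : ℝ) 1, F k (s, y) := by
    intro t ht k
    have h1 : IntegrableOn (F k) (Set.Icc 0 t ×ˢ Set.Icc 0 1) :=
      (hInt k).mono_set (Set.prod_mono_left (Set.Icc_subset_Icc_right ht.2))
    rw [Measure.volume_eq_prod] at h1
    unfold Bint
    rw [Measure.volume_eq_prod]
    exact setIntegral_prod _ h1
  refine ⟨fun k s => ∫ y in Set.Icc (0 : ℝ) 1, F k (s, y), ⟨?_, ?_, ?_, ?_, ?_, ?_⟩, ?_⟩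
  · intro k
    have : StronglyMeasurable (Function.uncurry fun s y => F k (s, y)) :=
      (hFm k).stronglyMeasurable
    exact this.integral_prod_right.measurable
  · exact fun k s => integral_nonneg fun y => hFnn k _
  · exact fun k => (hFi k).integral_prod_left
  · intro k
    refine Eventually.of_forall fun s hs => ?_
    have : ∀ y, F k (s, y) = 0 := fun y => by
      simp only [hF, hs]
      rw [if_neg]; intro hy; linarith [hy.1, hy.2]
    simp [this]
  · intro t ht
    rw [hpsi t ht]
    exact tsum_congr fun k => by rw [hB t ht k]
  · intro t ht k hk
    rw [hzeta t ht k hk, hB t ht k]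
  · unfold costE
    refine ENNReal.tsum_le_tsum fun k => ?_
    have hmeas : Measurable fun q : ℝ × ℝ => ENNReal.ofReal (ell (φ k q.1 q.2)) :=
      (continuous_ell.measurable.comp (hm k)).ennreal_ofReal
    rw [restrict_prod_Icc, lintegral_prod _ hmeas.aemeasurable]
    refine lintegral_mono_ae ?_
    filter_upwards [(hFi k).prod_right_ae] with s hs
    exact perspCost_integral_le (h.rcoord_nonneg s k) (h.rcoord_le_one hp s k)
      (fun y => hnn k s y) hs

/-- A flux is produced by a control of the same cost. -/
lemma IsFlux.exists_memST (h : PathReg p ζ) (hp : Summable fun k : ℕ => (k : ℝ) * p k)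
    {g : ℕ → ℝ → ℝ} (hg : IsFlux T p ζ ψ g) :
    ∃ φ, memST T p ζ ψ φ ∧ costE T φ ≤ ∑' k, fluxCost T ζ g k := by
  set r : ℕ → ℝ → ℝ := fun k s => rcoord (fun j => ζ j s) k with hr
  set φ : ℕ → ℝ → ℝ → ℝ := fun k s y => if 0 ≤ y ∧ y < r k s then g k s / r k s else 1 with hφ
  have hrm : ∀ k, Measurable (r k) := fun k => h.measurable_rcoord hp k
  have hr0 : ∀ k s, 0 ≤ r k s := fun k s => h.rcoord_nonneg s k
  have hr1 : ∀ k s, r k s ≤ 1 := fun k s => h.rcoord_le_one hp s k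
  have hset : ∀ k, MeasurableSet {q : ℝ × ℝ | 0 ≤ q.2 ∧ q.2 < r k q.1} := fun k =>
    h.measurableSet_lt_rcoord hp k
  have hm : ∀ k, Measurable fun q : ℝ × ℝ => φ k q.1 q.2 := fun k =>
    Measurable.ite (hset k) (((hg.meas k).comp measurable_fst).div
      ((hrm k).comp measurable_fst)) measurable_const
  have hnn : ∀ k s y, 0 ≤ φ k s y := fun k s y => by
    simp only [hφ]; split_ifs
    · exact div_nonneg (hg.nonneg k s) (hr0 k s)
    · exact zero_le_one
  set F : ℕ → ℝ × ℝ → ℝ := fun k q => if 0 ≤ q.2 ∧ q.2 < r k q.1 then φ k q.1 q.2 else 0 with hF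
  have hFm : ∀ k, Measurable (F k) := fun k => Measurable.ite (hset k) (hm k) measurable_const
  have hFind : ∀ k s, (fun y => F k (s, y)) =
      (Set.Ico 0 (r k s)).indicator fun _ => g k s / r k s := by
    intro k s
    ext y
    by_cases hy : 0 ≤ y ∧ y < r k s
    · simp [hF, hφ, hy]
    · simp [hF, hy]
  have hsub : ∀ k s, Set.Icc (0 : ℝ) 1 ∩ Set.Ico 0 (r k s) = Set.Ico 0 (r k s) := fun k s =>
    Set.inter_eq_right.2 (Set.Ico_subset_Icc_self.trans (Set.Icc_subset_Icc_right (hr1 k s)))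
  have hFint : ∀ k, ∀ᵐ s ∂volume.restrict (Set.Icc 0 T),
      ∫ y in Set.Icc (0 : ℝ) 1, F k (s, y) = g k s := by
    intro k
    filter_upwards [hg.vanish k] with s hs
    rw [hFind, setIntegral_indicator measurableSet_Ico, hsub]
    by_cases h0 : r k s = 0
    · simp [h0, hs h0]
    · simp [hr0 k s]
      field_simp
  have hFnn : ∀ k q, 0 ≤ F k q := fun k q => by simp only [hF]; split_ifs <;> simp [hnn]
  have hFi : ∀ k, IntegrableOn (F k) (Set.Icc 0 T ×ˢ Set.Icc 0 1) := by
    intro k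
    rw [IntegrableOn, restrict_prod_Icc, integrable_prod_iff (hFm k).aestronglyMeasurable]
    constructor
    · refine Eventually.of_forall fun s => ?_
      rw [hFind]
      exact (integrable_const _).indicator measurableSet_Ico
    · refine (hg.int k).congr ?_
      filter_upwards [hFint k] with s hs
      rw [← hs]
      simp_rw [Real.norm_of_nonneg (hFnn k _)]
  have hB : ∀ t ∈ Set.Icc (0 : ℝ) T, ∀ k, Bint ζ φ k t = ∫ s in Set.Icc 0 t, g k s := by
    intro t ht k
    have h1 : IntegrableOn (F k) (Set.Icc 0 t ×ˢ Set.Icc 0 1) :=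
      (hFi k).mono_set (Set.prod_mono_left (Set.Icc_subset_Icc_right ht.2))
    rw [Measure.volume_eq_prod] at h1
    have h2 : Bint ζ φ k t = ∫ s in Set.Icc 0 t, ∫ y in Set.Icc (0 : ℝ) 1, F k (s, y) := by
      unfold Bint
      rw [Measure.volume_eq_prod]
      exact setIntegral_prod _ h1
    rw [h2]
    exact integral_congr_ae
      (ae_restrict_of_ae_restrict_of_subset (Set.Icc_subset_Icc_right ht.2) (hFint k))
  refine ⟨φ, ⟨hm, hnn, hFi, ?_, ?_⟩, ?_⟩
  · intro t ht
    rw [hg.psi t ht]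
    exact tsum_congr fun k => by rw [hB t ht k]
  · intro t ht k hk
    rw [hg.zeta t ht k hk, hB t ht k]
  · refine ENNReal.tsum_le_tsum fun k => ?_
    have hmeas : Measurable fun q : ℝ × ℝ => ENNReal.ofReal (ell (φ k q.1 q.2)) :=
      (continuous_ell.measurable.comp (hm k)).ennreal_ofReal
    rw [restrict_prod_Icc, lintegral_prod _ hmeas.aemeasurable]
    refine lintegral_mono fun s => ?_
    have : (fun y => ENNReal.ofReal (ell (φ k s y))) =
        (Set.Ico 0 (r k s)).indicator fun _ => ENNReal.ofReal (ell (g k s / r k s)) := by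
      ext y
      by_cases hy : 0 ≤ y ∧ y < r k s
      · simp [hφ, hy]
      · simp [hφ, hy, ell_one]
    dsimp only
    rw [this, setLIntegral_indicator measurableSet_Ico, Set.inter_comm, hsub]
    simp only [lintegral_const, MeasurableSet.univ, Measure.restrict_apply, Set.univ_inter,
      Real.volume_Ico, sub_zero]
    unfold perspCost
    rw [mul_comm, ENNReal.ofReal_mul (hr0 k s)]

end

/-! ### Lower semicontinuity of the perspective cost under setwise convergence -/

section Lsc

variable {α : Type*} [MeasurableSpace α] {μ : Measure α}

lemma integrable_simpleFunc_mul {g : α → ℝ} (hg : Integrable g μ) (f : SimpleFunc α ℝ) :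
    Integrable (fun x => f x * g x) μ := by
  obtain ⟨C, hC⟩ := f.exists_forall_norm_le
  exact hg.bdd_mul f.measurable.aestronglyMeasurable (Eventually.of_forall hC)

lemma tendsto_integral_simpleFunc_mul {gs : ℕ → α → ℝ} {g : α → ℝ}
    (hgs : ∀ n, Integrable (gs n) μ) (hg : Integrable g μ)
    (hset : ∀ A, MeasurableSet A →
      Tendsto (fun n => ∫ x in A, gs n x ∂μ) atTop (𝓝 (∫ x in A, g x ∂μ)))
    (f : SimpleFunc α ℝ) :
    Tendsto (fun n => ∫ x, f x * gs n x ∂μ) atTop (𝓝 (∫ x, f x * g x ∂μ)) := by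
  induction f using SimpleFunc.induction with
  | const c hs =>
    rename_i s
    have key : ∀ h : α → ℝ, ∫ x, (SimpleFunc.piecewise s hs (SimpleFunc.const α c)
        (SimpleFunc.const α 0)) x * h x ∂μ = c * ∫ x in s, h x ∂μ := by
      intro h
      rw [← integral_const_mul, ← integral_indicator hs]
      congr 1
      ext x
      by_cases hx : x ∈ s <;> simp [hx]
    simp only [key]
    exact (hset s hs).const_mul c
  | @add f₁ f₂ _ h1 h2 =>
    have key : ∀ h : α → ℝ, Integrable h μ → ∫ x, (f₁ + f₂) x * h x ∂μ =
        ∫ x, f₁ x * h x ∂μ + ∫ x, f₂ x * h x ∂μ := by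
      intro h hh
      rw [← integral_add (integrable_simpleFunc_mul hh _) (integrable_simpleFunc_mul hh _)]
      simp [add_mul]
    simp only [key _ (hgs _), key _ hg]
    exact h1.add h2

/-- Simple functions lying between `1` and a nonnegative measurable function and converging
to it. -/
lemma exists_simpleFunc_between {u : α → ℝ} (hu : Measurable u) (hu0 : ∀ x, 0 ≤ u x) :
    ∃ c : ℕ → SimpleFunc α ℝ, (∀ m x, 0 < c m x) ∧
      (∀ m x, (1 ≤ c m x ∧ c m x ≤ u x) ∨ (u x ≤ c m x ∧ c m x ≤ 1)) ∧
      ∀ x, Tendsto (fun m => c m x) atTop (𝓝 (u x)) := by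
  set a : α → ℝ≥0∞ := fun x => ENNReal.ofReal (u x - 1)
  set b : α → ℝ≥0∞ := fun x => ENNReal.ofReal (1 - u x)
  have ha : Measurable a := (hu.sub_const 1).ennreal_ofReal
  have hb : Measurable b := (hu.const_sub 1).ennreal_ofReal
  have happ : ∀ (f : α → ℝ≥0∞), Measurable f → ∀ m x, SimpleFunc.eapprox f m x ≤ f x :=
    fun f hf m x => by
      rw [← SimpleFunc.iSup_eapprox_apply hf x]
      exact le_iSup (fun n => SimpleFunc.eapprox f n x) m
  set t : ℕ → ℝ := fun m => 1 - 1 / ((m : ℝ) + 2)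
  have ht0 : ∀ m, 0 ≤ t m := fun m => by
    have : 1 / ((m : ℝ) + 2) ≤ 1 := by
      rw [div_le_one (by positivity)]; linarith [m.cast_nonneg (α := ℝ)]
    simp only [t]; linarith
  have ht1 : ∀ m, t m < 1 := fun m => by
    have : 0 < 1 / ((m : ℝ) + 2) := by positivity
    simp only [t]; linarith
  have ht : Tendsto t atTop (𝓝 1) := by
    have : Tendsto (fun m : ℕ => 1 / ((m : ℝ) + 2)) atTop (𝓝 0) :=
      tendsto_const_nhds.div_atTop (tendsto_atTop_add_const_right _ _ tendsto_natCast_atTop_atTop)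
    simpa [t] using tendsto_const_nhds.sub this
  have hA : ∀ m x, (SimpleFunc.eapprox a m x).toReal ≤ max (u x - 1) 0 := fun m x => by
    rw [← ENNReal.toReal_ofReal']
    exact ENNReal.toReal_mono ENNReal.ofReal_ne_top (happ a ha m x)
  have hB : ∀ m x, (SimpleFunc.eapprox b m x).toReal ≤ max (1 - u x) 0 := fun m x => by
    rw [← ENNReal.toReal_ofReal']
    exact ENNReal.toReal_mono ENNReal.ofReal_ne_top (happ b hb m x)
  have hA0 : ∀ m x, 0 ≤ (SimpleFunc.eapprox a m x).toReal := fun m x => ENNReal.toReal_nonneg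
  have hB0 : ∀ m x, 0 ≤ (SimpleFunc.eapprox b m x).toReal := fun m x => ENNReal.toReal_nonneg
  set c : ℕ → SimpleFunc α ℝ := fun m =>
    SimpleFunc.const α 1 + (SimpleFunc.eapprox a m).map ENNReal.toReal -
      ((SimpleFunc.eapprox b m).map ENNReal.toReal).map (fun z => t m * z) with hc
  have hcx : ∀ m x, c m x = 1 + (SimpleFunc.eapprox a m x).toReal -
      t m * (SimpleFunc.eapprox b m x).toReal := fun m x => by simp [hc]
  refine ⟨c, fun m x => ?_, fun m x => ?_, fun x => ?_⟩
  · rw [hcx]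
    have h1 : (SimpleFunc.eapprox b m x).toReal ≤ 1 :=
      (hB m x).trans (max_le (by linarith [hu0 x]) zero_le_one)
    nlinarith [hA0 m x, hB0 m x, ht0 m, ht1 m]
  · rw [hcx]
    have h1 := hA m x
    have h2 := hB m x
    have h3 := hA0 m x
    have h4 := hB0 m x
    rcases le_total 1 (u x) with hx | hx
    · left
      rw [max_eq_right (by linarith)] at h2
      rw [max_eq_left (by linarith)] at h1
      have h5 : (SimpleFunc.eapprox b m x).toReal = 0 := le_antisymm h2 h4
      rw [h5]
      constructor <;> linarith
    · right
      rw [max_eq_right (by linarith)] at h1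
      rw [max_eq_left (by linarith)] at h2
      have h5 : (SimpleFunc.eapprox a m x).toReal = 0 := le_antisymm h1 h3
      rw [h5]
      constructor <;> nlinarith [ht0 m, ht1 m]
  · simp only [hcx]
    have h1 := (ENNReal.tendsto_toReal ENNReal.ofReal_ne_top).comp
      (SimpleFunc.tendsto_eapprox ha x)
    have h2 := (ENNReal.tendsto_toReal ENNReal.ofReal_ne_top).comp
      (SimpleFunc.tendsto_eapprox hb x)
    have h3 := ((tendsto_const_nhds (x := (1 : ℝ))).add h1).sub (ht.mul h2)
    refine Tendsto.congr (fun m => rfl) (h3.trans (le_of_eq ?_))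
    congr 1
    simp only [ENNReal.toReal_ofReal']
    rcases le_total 1 (u x) with hx | hx
    · rw [max_eq_left (by linarith), max_eq_right (by linarith)]; ring
    · rw [max_eq_right (by linarith), max_eq_left (by linarith)]; ring

variable [IsFiniteMeasure μ] {rs gs : ℕ → α → ℝ} {r g : α → ℝ}

lemma ofReal_integral_tangent_le_liminf
    (hrsm : ∀ n, Measurable (rs n)) (hrs0 : ∀ n x, 0 ≤ rs n x) (hrs1 : ∀ n x, rs n x ≤ 1)
    (hgs0 : ∀ n x, 0 ≤ gs n x)
    (hgs : ∀ n, Integrable (gs n) μ) (hg : Integrable g μ) (hri : Integrable r μ)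
    (hvan : ∀ n, ∀ᵐ x ∂μ, rs n x = 0 → gs n x = 0)
    (hr : ∀ᵐ x ∂μ, Tendsto (fun n => rs n x) atTop (𝓝 (r x)))
    (hset : ∀ A, MeasurableSet A →
      Tendsto (fun n => ∫ x in A, gs n x ∂μ) atTop (𝓝 (∫ x in A, g x ∂μ)))
    (c : SimpleFunc α ℝ) (hc : ∀ x, 0 < c x) :
    ENNReal.ofReal (∫ x, (r x * (1 - c x) + g x * Real.log (c x)) ∂μ) ≤
      liminf (fun n => ∫⁻ x, ENNReal.ofReal (perspCost (rs n x) (gs n x)) ∂μ) atTop := by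
  set d : SimpleFunc α ℝ := SimpleFunc.const α 1 - c
  set l : SimpleFunc α ℝ := c.map Real.log
  have hsplit : ∀ r g : α → ℝ, Integrable r μ → Integrable g μ →
      ∫ x, (r x * (1 - c x) + g x * Real.log (c x)) ∂μ =
        ∫ x, d x * r x ∂μ + ∫ x, l x * g x ∂μ := by
    intro r g hr hg
    rw [← integral_add (integrable_simpleFunc_mul hr _) (integrable_simpleFunc_mul hg _)]
    refine integral_congr_ae (Eventually.of_forall fun x => ?_)
    simp [d, l, mul_comm]
  have hrsi : ∀ n, Integrable (rs n) μ := fun n =>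
    (integrable_const (1 : ℝ)).mono' (hrsm n).aestronglyMeasurable
      (Eventually.of_forall fun x => by rw [Real.norm_of_nonneg (hrs0 n x)]; exact hrs1 n x)
  have hlim : Tendsto (fun n => ∫ x, (rs n x * (1 - c x) + gs n x * Real.log (c x)) ∂μ) atTop
      (𝓝 (∫ x, (r x * (1 - c x) + g x * Real.log (c x)) ∂μ)) := by
    rw [hsplit r g hri hg]
    simp only [hsplit _ _ (hrsi _) (hgs _)]
    refine Tendsto.add ?_ (tendsto_integral_simpleFunc_mul hgs hg hset l)
    obtain ⟨C, hC⟩ := d.exists_forall_norm_le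
    refine tendsto_integral_of_dominated_convergence (fun _ => C)
      (fun n => (integrable_simpleFunc_mul (hrsi n) d).aestronglyMeasurable)
      (integrable_const _) (fun n => Eventually.of_forall fun x => ?_) ?_
    · rw [norm_mul, Real.norm_of_nonneg (hrs0 n x)]
      exact (mul_le_of_le_one_right (norm_nonneg _) (hrs1 n x)).trans (hC x)
    · filter_upwards [hr] with x hx using hx.const_mul _
  have h1 := ((ENNReal.continuous_ofReal.tendsto _).comp hlim).liminf_eq
  rw [← h1]
  refine liminf_le_liminf (Eventually.of_forall fun n => ?_)
  have hi : Integrable (fun x => rs n x * (1 - c x) + gs n x * Real.log (c x)) μ := by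
    refine ((integrable_simpleFunc_mul (hrsi n) d).add
      (integrable_simpleFunc_mul (hgs n) l)).congr (Eventually.of_forall fun x => ?_)
    simp [d, l, mul_comm]
  refine (ofReal_integral_le_lintegral_ofReal hi).trans (lintegral_mono_ae ?_)
  filter_upwards [hvan n] with x hx
  exact ENNReal.ofReal_le_ofReal (perspCost_tangent_le (hrs0 n x) (hgs0 n x) hx (hc x))

/-- A limiting flux vanishes where the limiting rate does. -/
lemma ae_eq_zero_of_liminf_ne_top
    (hrsm : ∀ n, Measurable (rs n)) (hrs0 : ∀ n x, 0 ≤ rs n x) (hrs1 : ∀ n x, rs n x ≤ 1)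
    (hgs0 : ∀ n x, 0 ≤ gs n x) (hgs : ∀ n, Integrable (gs n) μ)
    (hrm : Measurable r) (hri : Integrable r μ) (hg0 : ∀ x, 0 ≤ g x) (hg : Integrable g μ)
    (hvan : ∀ n, ∀ᵐ x ∂μ, rs n x = 0 → gs n x = 0)
    (hr : ∀ᵐ x ∂μ, Tendsto (fun n => rs n x) atTop (𝓝 (r x)))
    (hset : ∀ A, MeasurableSet A →
      Tendsto (fun n => ∫ x in A, gs n x ∂μ) atTop (𝓝 (∫ x in A, g x ∂μ)))
    (hfin : liminf (fun n => ∫⁻ x, ENNReal.ofReal (perspCost (rs n x) (gs n x)) ∂μ) atTop ≠ ⊤) :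
    ∀ᵐ x ∂μ, r x = 0 → g x = 0 := by
  set L := liminf (fun n => ∫⁻ x, ENNReal.ofReal (perspCost (rs n x) (gs n x)) ∂μ) atTop
  have hA : MeasurableSet {x | r x = 0} := hrm (measurableSet_singleton 0)
  have key : ∀ m : ℕ, (m : ℝ) * ∫ x in {x | r x = 0}, g x ∂μ ≤ L.toReal := by
    intro m
    set c : SimpleFunc α ℝ := SimpleFunc.piecewise _ hA (SimpleFunc.const α (Real.exp m))
      (SimpleFunc.const α 1)
    have hc : ∀ x, 0 < c x := fun x => by
      simp only [c, SimpleFunc.piecewise_apply]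
      split_ifs <;> simp [Real.exp_pos]
    have h := ofReal_integral_tangent_le_liminf hrsm hrs0 hrs1 hgs0 hgs hg hri hvan hr hset c hc
    have h2 : ∫ x, (r x * (1 - c x) + g x * Real.log (c x)) ∂μ =
        m * ∫ x in {x | r x = 0}, g x ∂μ := by
      rw [← integral_const_mul, ← integral_indicator hA]
      congr 1
      ext x
      by_cases hx : r x = 0
      · simp [c, hx, mul_comm]
      · simp [c, hx]
    rw [h2] at h
    exact (ENNReal.ofReal_le_iff_le_toReal hfin).1 h
  have h0 : ∫ x in {x | r x = 0}, g x ∂μ = 0 := by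
    refine le_antisymm ?_ (integral_nonneg hg0)
    by_contra! hpos
    obtain ⟨m, hm⟩ := exists_nat_gt (L.toReal / ∫ x in {x | r x = 0}, g x ∂μ)
    rw [div_lt_iff₀ hpos] at hm
    exact absurd (key m) (not_le.2 hm)
  rw [integral_eq_zero_iff_of_nonneg hg0 hg.integrableOn] at h0
  exact (ae_restrict_iff' hA).1 h0

/-- Lower semicontinuity of the perspective cost. -/
lemma lintegral_perspCost_le_liminf
    (hrsm : ∀ n, Measurable (rs n)) (hrs0 : ∀ n x, 0 ≤ rs n x) (hrs1 : ∀ n x, rs n x ≤ 1)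
    (hgs0 : ∀ n x, 0 ≤ gs n x) (hgs : ∀ n, Integrable (gs n) μ)
    (hrm : Measurable r) (hri : Integrable r μ) (hr0 : ∀ x, 0 ≤ r x)
    (hgm : Measurable g) (hg0 : ∀ x, 0 ≤ g x) (hg : Integrable g μ)
    (hvan : ∀ n, ∀ᵐ x ∂μ, rs n x = 0 → gs n x = 0)
    (hr : ∀ᵐ x ∂μ, Tendsto (fun n => rs n x) atTop (𝓝 (r x)))
    (hset : ∀ A, MeasurableSet A →
      Tendsto (fun n => ∫ x in A, gs n x ∂μ) atTop (𝓝 (∫ x in A, g x ∂μ)))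
    (hfin : liminf (fun n => ∫⁻ x, ENNReal.ofReal (perspCost (rs n x) (gs n x)) ∂μ) atTop ≠ ⊤) :
    ∫⁻ x, ENNReal.ofReal (perspCost (r x) (g x)) ∂μ ≤
      liminf (fun n => ∫⁻ x, ENNReal.ofReal (perspCost (rs n x) (gs n x)) ∂μ) atTop := by
  have hz := ae_eq_zero_of_liminf_ne_top hrsm hrs0 hrs1 hgs0 hgs hrm hri hg0 hg hvan hr hset hfin
  obtain ⟨c, hcpos, hcb, hclim⟩ := exists_simpleFunc_between (hgm.div hrm)
    fun x => div_nonneg (hg0 x) (hr0 x)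
  set h : ℕ → α → ℝ := fun m x => r x * (1 - c m x) + g x * Real.log (c m x) with hh
  have hhi : ∀ m, Integrable (h m) μ := fun m => by
    refine ((integrable_simpleFunc_mul hri (SimpleFunc.const α 1 - c m)).add
      (integrable_simpleFunc_mul hg ((c m).map Real.log))).congr
      (Eventually.of_forall fun x => ?_)
    simp [hh, mul_comm]
  have hh0 : ∀ m, ∀ᵐ x ∂μ, 0 ≤ h m x := fun m => by
    filter_upwards [hz] with x hx
    rcases (hr0 x).eq_or_lt with h0 | hpos
    · simp [hh, ← h0, hx h0.symm]
    · have h1 : h m x = r x * (ell (c m x) + Real.log (c m x) * (g x / r x - c m x)) := by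
        simp only [hh, ell]; field_simp; ring
      rw [h1]
      refine mul_nonneg hpos.le (add_nonneg (ell_nonneg (hcpos m x).le) ?_)
      rcases hcb m x with ⟨h2, h3⟩ | ⟨h2, h3⟩
      · exact mul_nonneg (Real.log_nonneg h2) (sub_nonneg.2 h3)
      · exact mul_nonneg_of_nonpos_of_nonpos (Real.log_nonpos (hcpos m x).le h3)
          (sub_nonpos.2 h2)
  have hhlim : ∀ᵐ x ∂μ, Tendsto (fun m => h m x) atTop (𝓝 (perspCost (r x) (g x))) := by
    filter_upwards [hz] with x hx
    rcases (hr0 x).eq_or_lt with h0 | hpos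
    · simp [hh, ← h0, hx h0.symm, perspCost]
    · have h1 := hclim x
      rcases (hg0 x).eq_or_lt with hg | hg
      · have h2 : (g / r) x = 0 := by simp [← hg]
        have h3 := ((tendsto_const_nhds (x := (1 : ℝ))).sub h1).const_mul (r x)
        simpa [hh, ← hg, perspCost, ell_zero, h2] using h3
      · have h2 : (g / r) x ≠ 0 := by simp only [Pi.div_apply]; positivity
        have h3 := (((tendsto_const_nhds (x := (1 : ℝ))).sub h1).const_mul (r x)).add
          (((Real.continuousAt_log h2).tendsto.comp h1).const_mul (g x))
        refine h3.trans (le_of_eq ?_)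
        congr 1
        simp only [Pi.div_apply, perspCost, ell]
        field_simp
        ring
  calc ∫⁻ x, ENNReal.ofReal (perspCost (r x) (g x)) ∂μ
      = ∫⁻ x, liminf (fun m => ENNReal.ofReal (h m x)) atTop ∂μ := by
        refine lintegral_congr_ae ?_
        filter_upwards [hhlim] with x hx
        exact ((ENNReal.continuous_ofReal.tendsto _).comp hx).liminf_eq.symm
    _ ≤ liminf (fun m => ∫⁻ x, ENNReal.ofReal (h m x) ∂μ) atTop :=
        lintegral_liminf_le' fun m => (hhi m).aestronglyMeasurable.aemeasurable.ennreal_ofReal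
    _ ≤ _ := by
        refine liminf_le_of_le (by isBoundedDefault) fun b hb => ?_
        obtain ⟨m, hm⟩ := hb.exists
        refine hm.trans ?_
        rw [← ofReal_integral_eq_lintegral_ofReal (hhi m) (hh0 m)]
        exact ofReal_integral_tangent_le_liminf hrsm hrs0 hrs1 hgs0 hgs hg hri hvan hr hset
          (c m) (hcpos m)

end Lsc

/-! ### Setwise limits of uniformly integrable sequences -/

lemma tendsto_setIntegral_of_tendsto_Iic {μ : Measure ℝ} [IsFiniteMeasure μ]
    {gs : ℕ → ℝ → ℝ} {g : ℝ → ℝ} (hgs0 : ∀ n s, 0 ≤ gs n s) (hgs : ∀ n, Integrable (gs n) μ)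
    (hg : Integrable g μ)
    (hui : ∀ ε : ℝ, 0 < ε → ∃ δ : ℝ, 0 < δ ∧ ∀ n A, MeasurableSet A → μ A < ENNReal.ofReal δ →
      ∫ s in A, gs n s ∂μ ≤ ε)
    (htot : Tendsto (fun n => ∫ s, gs n s ∂μ) atTop (𝓝 (∫ s, g s ∂μ)))
    (hIic : ∀ t, Tendsto (fun n => ∫ s in Set.Iic t, gs n s ∂μ) atTop
      (𝓝 (∫ s in Set.Iic t, g s ∂μ))) (A : Set ℝ) (hA : MeasurableSet A) :
    Tendsto (fun n => ∫ s in A, gs n s ∂μ) atTop (𝓝 (∫ s in A, g s ∂μ)) := by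
  induction A, hA using MeasurableSpace.induction_on_inter
    ((BorelSpace.measurable_eq (α := ℝ)).trans (borel_eq_generateFrom_Iic ℝ)) isPiSystem_Iic with
  | empty => simp
  | basic t ht =>
    obtain ⟨q, rfl⟩ := ht
    exact hIic q
  | compl t ht ih =>
    have hc : ∀ f : ℝ → ℝ, Integrable f μ →
        ∫ s in tᶜ, f s ∂μ = (∫ s, f s ∂μ) - ∫ s in t, f s ∂μ := fun f hf => by
      rw [← integral_add_compl ht hf]; ring
    simp_rw [hc _ (hgs _), hc _ hg]
    exact htot.sub ih
  | iUnion f hd hfm ih =>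
    set S : ℕ → Set ℝ := fun m => ⋃ i ∈ Finset.range m, f i with hS
    have hSm : ∀ m, MeasurableSet (S m) := fun m =>
      Finset.measurableSet_biUnion _ fun i _ => hfm i
    have hSU : ⋃ m, S m = ⋃ i, f i := by
      ext x
      simp only [hS, Set.mem_iUnion, Finset.mem_range, exists_prop]
      exact ⟨fun ⟨m, i, _, hx⟩ => ⟨i, hx⟩, fun ⟨i, hx⟩ => ⟨i + 1, i, i.lt_succ_self, hx⟩⟩
    have hSmono : Monotone S := fun a b hab => by
      refine Set.biUnion_subset_biUnion_left fun i hi => ?_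
      simp only [Finset.coe_range, Set.mem_Iio] at hi ⊢
      exact hi.trans_le hab
    have hsplit : ∀ h : ℝ → ℝ, Integrable h μ → ∀ m,
        ∫ s in S m, h s ∂μ = ∑ i ∈ Finset.range m, ∫ s in f i, h s ∂μ := fun h hh m =>
      integral_biUnion_finset _ (fun i _ => hfm i) (fun i _ j _ hij => hd hij)
        fun i _ => hh.integrableOn
    have hzero : Tendsto (fun m => μ ((⋃ i, f i) \ S m)) atTop (𝓝 0) := by
      have h := tendsto_measure_iInter_atTop (μ := μ) (s := fun m => (⋃ i, f i) \ S m)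
        (fun m => ((MeasurableSet.iUnion hfm).diff (hSm m)).nullMeasurableSet)
        (fun a b hab => Set.sdiff_subset_sdiff_right (hSmono hab)) ⟨0, measure_ne_top _ _⟩
      rwa [← Set.sdiff_iUnion, hSU, Set.sdiff_self, measure_empty] at h
    refine TendstoUniformlyOnFilter.tendsto_of_eventually_tendsto
      (F := fun m n => ∫ s in S m, gs n s ∂μ) (p := atTop) (L := fun m => ∫ s in S m, g s ∂μ)
      ?_ (Eventually.of_forall fun m => ?_) ?_
    · refine (TendstoUniformly.tendstoUniformlyOnFilter
        (f := fun n => ∫ s in ⋃ i, f i, gs n s ∂μ) ?_).mono_right le_top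
      refine Metric.tendstoUniformly_iff.2 fun ε hε => ?_
      obtain ⟨δ, hδ, h⟩ := hui (ε / 2) (half_pos hε)
      filter_upwards [hzero.eventually (gt_mem_nhds (ENNReal.ofReal_pos.2 hδ))] with m hm n
      have h1 := h n _ ((MeasurableSet.iUnion hfm).diff (hSm m)) hm
      have h2 : ∫ s in (⋃ i, f i) \ S m, gs n s ∂μ =
          (∫ s in ⋃ i, f i, gs n s ∂μ) - ∫ s in S m, gs n s ∂μ :=
        setIntegral_sdiff (hSm m) (hgs n).integrableOn (hSU ▸ Set.subset_iUnion S m)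
      have h3 : 0 ≤ ∫ s in (⋃ i, f i) \ S m, gs n s ∂μ := integral_nonneg fun s => hgs0 n s
      rw [Real.dist_eq, ← h2, abs_of_nonneg h3]
      linarith
    · simp_rw [hsplit _ (hgs _), hsplit _ hg]
      exact tendsto_finsetSum _ fun i _ => ih i
    · rw [← hSU]
      exact tendsto_setIntegral_of_monotone hSm hSmono hg.integrableOn

lemma setIntegral_Icc_eq_intervalIntegral {f : ℝ → ℝ} {a b : ℝ} (hab : a ≤ b) :
    ∫ s in Set.Icc a b, f s = ∫ s in a..b, f s := by
  rw [integral_Icc_eq_integral_Ioc, intervalIntegral.integral_of_le hab]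

lemma setIntegral_Icc_sub_setIntegral_Icc {f : ℝ → ℝ} {T a b : ℝ}
    (hf : IntegrableOn f (Set.Icc 0 T)) (ha : 0 ≤ a) (hab : a ≤ b) (hb : b ≤ T) :
    (∫ s in Set.Icc 0 b, f s) - ∫ s in Set.Icc 0 a, f s = ∫ s in Set.Ioc a b, f s := by
  have hi : ∀ c d, 0 ≤ c → c ≤ d → d ≤ T → IntervalIntegrable f volume c d := fun c d hc hcd hd =>
    (intervalIntegrable_iff_integrableOn_Icc_of_le hcd).2 (hf.mono_set (Set.Icc_subset_Icc hc hd))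
  rw [setIntegral_Icc_eq_intervalIntegral ha, setIntegral_Icc_eq_intervalIntegral (ha.trans hab),
    ← intervalIntegral.integral_of_le hab, sub_eq_iff_eq_add,
    add_comm, intervalIntegral.integral_add_adjacent_intervals (hi _ _ le_rfl ha (hab.trans hb))
      (hi _ _ ha hab hb)]

lemma exists_setwise_limit {T : ℝ} (hT : 0 < T) {gs : ℕ → ℝ → ℝ} {B : ℝ → ℝ}
    (hgs0 : ∀ n s, 0 ≤ gs n s) (hgs : ∀ n, IntegrableOn (gs n) (Set.Icc 0 T))
    (hui : ∀ ε : ℝ, 0 < ε → ∃ δ : ℝ, 0 < δ ∧ ∀ n A, MeasurableSet A →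
      volume.restrict (Set.Icc 0 T) A < ENNReal.ofReal δ →
      ∫ s in A, gs n s ∂(volume.restrict (Set.Icc 0 T)) ≤ ε)
    (hB : ∀ t ∈ Set.Icc 0 T, Tendsto (fun n => ∫ s in Set.Icc 0 t, gs n s) atTop (𝓝 (B t))) :
    ∃ g : ℝ → ℝ, Measurable g ∧ (∀ s, 0 ≤ g s) ∧ IntegrableOn g (Set.Icc 0 T) ∧
      ∀ A, MeasurableSet A → Tendsto (fun n => ∫ s in A, gs n s ∂(volume.restrict (Set.Icc 0 T)))
        atTop (𝓝 (∫ s in A, g s ∂(volume.restrict (Set.Icc 0 T)))) := by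
  set c : ℝ → ℝ := fun s => max 0 (min T s) with hc
  have hcm : ∀ s, c s ∈ Set.Icc 0 T := fun s =>
    ⟨le_max_left _ _, max_le hT.le (min_le_left _ _)⟩
  have hcmono : Monotone c := fun a b hab => max_le_max le_rfl (min_le_min le_rfl hab)
  have hcid : ∀ s ∈ Set.Icc 0 T, c s = s := fun s hs => by
    rw [hc]; dsimp only; rw [min_eq_right hs.2, max_eq_right hs.1]
  have hlim : ∀ s, Tendsto (fun n => ∫ u in Set.Icc 0 (c s), gs n u) atTop (𝓝 (B (c s))) :=
    fun s => hB _ (hcm s)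
  have hinc : ∀ n a b, a ≤ b → (∫ u in Set.Icc 0 (c b), gs n u) - ∫ u in Set.Icc 0 (c a), gs n u =
      ∫ u in Set.Ioc (c a) (c b), gs n u := fun n a b hab =>
    setIntegral_Icc_sub_setIntegral_Icc (hgs n) (hcm a).1 (hcmono hab) (hcm b).2
  have hmono : Monotone fun s => B (c s) := fun a b hab => by
    refine le_of_tendsto_of_tendsto' (hlim a) (hlim b) fun n => ?_
    have := hinc n a b hab
    have h2 : 0 ≤ ∫ u in Set.Ioc (c a) (c b), gs n u := integral_nonneg fun s => hgs0 n s
    linarith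
  have hac : AbsolutelyContinuousOnInterval (fun s => B (c s)) 0 T := by
    rw [absolutelyContinuousOnInterval_iff]
    intro ε hε
    obtain ⟨δ, hδ, h⟩ := hui (ε / 2) (half_pos hε)
    refine ⟨δ, hδ, fun E hE hlen => ?_⟩
    obtain ⟨m, I⟩ := E
    have hsub := AbsolutelyContinuousOnInterval.biUnion_uIoc_subset_of_mem_disjWithin hE
    obtain ⟨hI, hdis⟩ := hE
    dsimp only at hI hdis hlen ⊢
    rw [Set.uIcc_of_le hT.le] at hI
    rw [Set.uIoc_of_le hT.le] at hsub
    set A : Set ℝ := ⋃ i ∈ Finset.range m, Set.uIoc (I i).1 (I i).2 with hAdef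
    have hAm : MeasurableSet A := Finset.measurableSet_biUnion _ fun i _ => measurableSet_uIoc
    have hlt : volume.restrict (Set.Icc 0 T) A < ENNReal.ofReal δ := by
      refine ((Measure.restrict_apply_le _ _).trans ((measure_biUnion_finset_le _ _).trans ?_)).trans_lt
        ((ENNReal.ofReal_lt_ofReal_iff hδ).2 hlen)
      rw [ENNReal.ofReal_sum_of_nonneg fun i _ => dist_nonneg]
      refine Finset.sum_le_sum fun i _ => ?_
      rw [Set.uIoc, Real.volume_Ioc, Real.dist_eq, max_sub_min_eq_abs, abs_sub_comm]
    have hle : ∀ n, ∑ i ∈ Finset.range m, dist (∫ u in Set.Icc 0 (c (I i).1), gs n u)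
        (∫ u in Set.Icc 0 (c (I i).2), gs n u) ≤ ε / 2 := fun n => by
      refine le_of_eq_of_le ?_ (h n A hAm hlt)
      rw [Measure.restrict_restrict hAm,
        Set.inter_eq_left.2 (hsub.trans Set.Ioc_subset_Icc_self), hAdef,
        integral_biUnion_finset _ (fun i _ => measurableSet_uIoc) hdis fun i hi =>
          (hgs n).mono_set ((Set.subset_biUnion_of_mem (u := fun i => Set.uIoc (I i).1 (I i).2)
            (by simpa using hi)).trans (hsub.trans Set.Ioc_subset_Icc_self))]
      refine Finset.sum_congr rfl fun i hi => ?_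
      have h0 : ∀ a b, 0 ≤ ∫ u in Set.Ioc a b, gs n u := fun a b =>
        integral_nonneg fun s => hgs0 n s
      rcases le_total (I i).1 (I i).2 with hle | hle
      · have := hinc n _ _ hle
        rw [hcid _ (hI i hi).1, hcid _ (hI i hi).2] at this ⊢
        rw [Set.uIoc_of_le hle, dist_comm, Real.dist_eq, this, abs_of_nonneg (h0 _ _)]
      · have := hinc n _ _ hle
        rw [hcid _ (hI i hi).1, hcid _ (hI i hi).2] at this ⊢
        rw [Set.uIoc_of_ge hle, Real.dist_eq, this, abs_of_nonneg (h0 _ _)]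
    refine lt_of_le_of_lt (le_of_tendsto' (tendsto_finsetSum _ fun i _ =>
      (hlim (I i).1).dist (hlim (I i).2)) hle) (half_lt_self hε)
  have hgi : IntegrableOn (deriv fun s => B (c s)) (Set.Icc 0 T) :=
    (intervalIntegrable_iff_integrableOn_Icc_of_le hT.le).1 hac.intervalIntegrable_deriv
  have hB0 : B (c 0) = 0 := by
    refine tendsto_nhds_unique (hlim 0) ?_
    rw [hcid 0 ⟨le_rfl, hT.le⟩]
    simp
  have hgB : ∀ t, ∫ s in Set.Icc 0 (c t), deriv (fun s => B (c s)) s = B (c t) := fun t => by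
    rw [setIntegral_Icc_eq_intervalIntegral (hcm t).1, (hac.mono ?_).integral_deriv_eq_sub, hB0,
      sub_zero, hcid _ (hcm t)]
    rw [Set.uIcc_of_le hT.le, Set.uIcc_of_le (hcm t).1]
    exact Set.Icc_subset_Icc_right (hcm t).2
  refine ⟨deriv fun s => B (c s), measurable_deriv _, fun s => hmono.deriv_nonneg, hgi, ?_⟩
  have hcT : c T = T := hcid T ⟨hT.le, le_rfl⟩
  refine tendsto_setIntegral_of_tendsto_Iic hgs0 hgs hgi hui ?_ fun t => ?_
  · have := hlim T
    rwa [← hgB, hcT] at this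
  · rw [Measure.restrict_restrict measurableSet_Iic]
    rcases lt_or_ge t 0 with ht | ht
    · have : Set.Iic t ∩ Set.Icc 0 T = ∅ := by
        ext x; simp only [Set.mem_inter_iff, Set.mem_Iic, Set.mem_Icc, Set.mem_empty_iff_false,
          iff_false]; rintro ⟨h1, h2, _⟩; linarith
      simp [this]
    · have : Set.Iic t ∩ Set.Icc 0 T = Set.Icc 0 (c t) := by
        ext x
        simp only [hc, Set.mem_inter_iff, Set.mem_Iic, Set.mem_Icc, le_max_iff, le_min_iff]
        constructor
        · rintro ⟨h1, h2, h3⟩; exact ⟨h2, Or.inr ⟨h3, h1⟩⟩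
        · rintro ⟨h1, h2 | h2⟩
          · exact ⟨h2.trans ht, h1, h2.trans hT.le⟩
          · exact ⟨h2.2, h1, h2.1⟩
      rw [this, hgB]
      exact hlim t

/-! ### Uniform integrability from a cost bound -/

lemma mul_setIntegral_le_of_lintegral_perspCost_le {α : Type*} [MeasurableSpace α]
    {μ : Measure α} [IsFiniteMeasure μ] {r g : α → ℝ} {M a : ℝ} (hM : 0 ≤ M) (ha : 0 ≤ a)
    (hr0 : ∀ x, 0 ≤ r x) (hr1 : ∀ x, r x ≤ 1) (hg0 : ∀ x, 0 ≤ g x) (hg : Integrable g μ)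
    (hvan : ∀ᵐ x ∂μ, r x = 0 → g x = 0)
    (hcost : ∫⁻ x, ENNReal.ofReal (perspCost (r x) (g x)) ∂μ ≤ ENNReal.ofReal M) (A : Set α) :
    a * ∫ x in A, g x ∂μ ≤ M + (Real.exp a - 1) * μ.real A := by
  have h1 : ∫ x in A, (a * g x - (Real.exp a - 1)) ∂μ =
      a * (∫ x in A, g x ∂μ) - (Real.exp a - 1) * μ.real A := by
    rw [integral_sub (hg.integrableOn.const_mul a) (integrable_const _), integral_const_mul]
    simp [mul_comm]
  have h2 : ENNReal.ofReal (∫ x in A, (a * g x - (Real.exp a - 1)) ∂μ) ≤ ENNReal.ofReal M := by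
    refine (ofReal_integral_le_lintegral_ofReal
      ((hg.integrableOn.const_mul a).sub (integrable_const _))).trans (le_trans ?_ hcost)
    refine le_trans (lintegral_mono_ae ?_) (setLIntegral_le_lintegral A _)
    filter_upwards [ae_restrict_of_ae hvan] with x hx
    refine ENNReal.ofReal_le_ofReal ?_
    have h := perspCost_tangent_le (hr0 x) (hg0 x) hx (Real.exp_pos a)
    rw [Real.log_exp] at h
    have h3 := mul_le_mul_of_nonneg_right (hr1 x) (sub_nonneg.2 (Real.one_le_exp ha))
    dsimp only [Pi.sub_apply]
    linarith
  have h3 := (ENNReal.ofReal_le_ofReal_iff hM).1 h2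
  linarith

lemma exists_forall_setIntegral_le {M ε : ℝ} (hM : 0 ≤ M) (hε : 0 < ε) :
    ∃ δ : ℝ, 0 < δ ∧ ∀ {α : Type} [MeasurableSpace α] (μ : Measure α) [IsFiniteMeasure μ]
      (r g : α → ℝ), (∀ x, 0 ≤ r x) → (∀ x, r x ≤ 1) → (∀ x, 0 ≤ g x) → Integrable g μ →
      (∀ᵐ x ∂μ, r x = 0 → g x = 0) →
      ∫⁻ x, ENNReal.ofReal (perspCost (r x) (g x)) ∂μ ≤ ENNReal.ofReal M →
      ∀ A, μ A < ENNReal.ofReal δ → ∫ x in A, g x ∂μ ≤ ε := by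
  set a : ℝ := 2 * M / ε + 1 with ha
  have ha1 : 0 < a := by positivity
  have he : 0 < Real.exp a - 1 := by linarith [Real.add_one_lt_exp ha1.ne']
  refine ⟨a * ε / 2 / (Real.exp a - 1), by positivity, ?_⟩
  intro α _ μ _ r g hr0 hr1 hg0 hg hvan hcost A hA
  have h := mul_setIntegral_le_of_lintegral_perspCost_le hM ha1.le hr0 hr1 hg0 hg hvan hcost A
  have h2 : μ.real A ≤ a * ε / 2 / (Real.exp a - 1) :=
    ENNReal.toReal_le_of_le_ofReal (by positivity) hA.le
  have h3 : (Real.exp a - 1) * μ.real A ≤ a * ε / 2 := by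
    rw [le_div_iff₀ he] at h2; linarith
  have h4 : M ≤ a * ε / 2 := by rw [ha]; field_simp; linarith
  exact le_of_mul_le_mul_left (by linarith) ha1

/-! ### The Skorokhod map -/

lemma skorokhod_add_min (ψ : ℝ → ℝ) (t : ℝ) :
    skorokhod ψ t + min (sInf (ψ '' Set.Icc 0 t)) 0 = ψ t := by
  unfold skorokhod; ring

section Skorokhod

variable {T : ℝ} {ψ : ℝ → ℝ}

lemma bddBelow_image_Icc (hψ : ContinuousOn ψ (Set.Icc 0 T)) {t : ℝ} (ht : t ≤ T) :
    BddBelow (ψ '' Set.Icc 0 t) :=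
  (isCompact_Icc.image_of_continuousOn (hψ.mono (Set.Icc_subset_Icc_right ht))).bddBelow

lemma min_sInf_antitone (hψ : ContinuousOn ψ (Set.Icc 0 T)) {a b : ℝ} (ha : 0 ≤ a) (hab : a ≤ b)
    (hb : b ≤ T) : min (sInf (ψ '' Set.Icc 0 b)) 0 ≤ min (sInf (ψ '' Set.Icc 0 a)) 0 :=
  min_le_min_right 0 (csInf_le_csInf (bddBelow_image_Icc hψ hb)
    ((Set.nonempty_Icc.2 ha).image ψ) (Set.image_mono (Set.Icc_subset_Icc_right hab)))

lemma skorokhod_nonneg (hψ : ContinuousOn ψ (Set.Icc 0 T)) {t : ℝ} (ht : t ∈ Set.Icc 0 T) :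
    0 ≤ skorokhod ψ t :=
  sub_nonneg.2 ((min_le_left _ _).trans (csInf_le (bddBelow_image_Icc hψ ht.2)
    ⟨t, ⟨ht.1, le_rfl⟩, rfl⟩))

lemma exists_eq_min_sInf (hψ : ContinuousOn ψ (Set.Icc 0 T)) {a b : ℝ} (ha : 0 ≤ a) (hab : a ≤ b)
    (hb : b ≤ T)
    (hlt : min (sInf (ψ '' Set.Icc 0 b)) 0 < min (sInf (ψ '' Set.Icc 0 a)) 0) :
    ∃ s ∈ Set.Icc a b, ψ s = min (sInf (ψ '' Set.Icc 0 b)) 0 ∧ skorokhod ψ s = 0 := by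
  have hneg : sInf (ψ '' Set.Icc 0 b) < 0 := by
    by_contra h
    rw [min_eq_right (not_lt.1 h)] at hlt
    exact absurd hlt (not_lt.2 (min_le_right _ _))
  obtain ⟨s, hs, hsm⟩ := (isCompact_Icc.image_of_continuousOn
    (hψ.mono (Set.Icc_subset_Icc_right hb))).sInf_mem ((Set.nonempty_Icc.2 (ha.trans hab)).image ψ)
  have heq : ψ s = min (sInf (ψ '' Set.Icc 0 b)) 0 := by rw [hsm, min_eq_left hneg.le]
  have hsa : a ≤ s := by
    by_contra h
    have h1 : sInf (ψ '' Set.Icc 0 a) ≤ ψ s :=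
      csInf_le (bddBelow_image_Icc hψ (hab.trans hb)) ⟨s, ⟨hs.1, (not_le.1 h).le⟩, rfl⟩
    rw [← heq] at hlt
    exact absurd hlt (not_lt.2 ((min_le_left _ _).trans h1))
  refine ⟨s, ⟨hsa, hs.2⟩, heq, le_antisymm ?_ (skorokhod_nonneg hψ ⟨hs.1, hs.2.trans hb⟩)⟩
  have := min_sInf_antitone hψ hs.1 hs.2 hb
  unfold skorokhod
  linarith

/-- The increments of a reflected path are dominated by those of an upward driver. -/
lemma skorokhod_sub_le (hψ : ContinuousOn ψ (Set.Icc 0 T)) {W : ℝ → ℝ}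
    (hW : MonotoneOn W (Set.Icc 0 T))
    (hinc : ∀ a b, 0 ≤ a → a ≤ b → b ≤ T → ψ b - ψ a ≤ W b - W a) {a b : ℝ} (ha : 0 ≤ a)
    (hab : a ≤ b) (hb : b ≤ T) : skorokhod ψ b - skorokhod ψ a ≤ W b - W a := by
  rcases (min_sInf_antitone hψ ha hab hb).lt_or_eq with hlt | heq
  · obtain ⟨s, hs, hsm, -⟩ := exists_eq_min_sInf hψ ha hab hb hlt
    have h1 := hinc s b (ha.trans hs.1) hs.2 hb
    have h2 := hW ⟨ha, hab.trans hb⟩ ⟨ha.trans hs.1, hs.2.trans hb⟩ hs.1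
    have h3 := skorokhod_nonneg hψ (t := a) ⟨ha, hab.trans hb⟩
    have h4 := skorokhod_add_min ψ b
    linarith
  · have h1 := hinc a b ha hab hb
    have h4 := skorokhod_add_min ψ b
    have h5 := skorokhod_add_min ψ a
    linarith

lemma two_mul_setIntegral_indicator_le (hψ : ContinuousOn ψ (Set.Icc 0 T)) {z W g : ℝ → ℝ}
    (hz : Continuous z) (hzψ : ∀ t ∈ Set.Icc 0 T, z t = skorokhod ψ t)
    (hW : MonotoneOn W (Set.Icc 0 T)) (hg0 : ∀ s, 0 ≤ g s) (hg : IntegrableOn g (Set.Icc 0 T))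
    (hinc : ∀ a b, 0 ≤ a → a ≤ b → b ≤ T →
      ψ b - ψ a + 2 * ∫ s in Set.Ioc a b, g s ≤ W b - W a) {ε : ℝ} (hε : 0 < ε) {τ : ℝ}
    (hτ : τ ∈ Set.Icc 0 T) :
    2 * ∫ s in Set.Ioc τ T, {s | ε ≤ z s}.indicator g s ≤ z τ - z T + (W T - W τ) := by
  have hmeas : MeasurableSet {s | ε ≤ z s} := measurableSet_le measurable_const hz.measurable
  have hind : IntegrableOn ({s | ε ≤ z s}.indicator g) (Set.Icc 0 T) := hg.indicator hmeas
  have hinc' : ∀ a b, 0 ≤ a → a ≤ b → b ≤ T → ψ b - ψ a ≤ W b - W a := fun a b h1 h2 h3 => by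
    have := hinc a b h1 h2 h3
    have h4 : 0 ≤ ∫ s in Set.Ioc a b, g s := integral_nonneg hg0
    linarith
  obtain ⟨δ, hδ, hδz⟩ := Metric.uniformContinuousOn_iff_le.1
    (isCompact_Icc.uniformContinuousOn_of_continuous (s := Set.Icc 0 T) hz.continuousOn) (ε / 2)
    (half_pos hε)
  have hstep : ∀ a b, 0 ≤ a → a ≤ b → b ≤ T → b - a ≤ δ →
      2 * ∫ s in Set.Ioc a b, {s | ε ≤ z s}.indicator g s ≤ z a - z b + (W b - W a) := by
    intro a b ha hab hb hlen
    rw [hzψ a ⟨ha, hab.trans hb⟩, hzψ b ⟨ha.trans hab, hb⟩]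
    rcases (min_sInf_antitone hψ ha hab hb).lt_or_eq with hlt | heq
    · obtain ⟨s, hs, -, hs0⟩ := exists_eq_min_sInf hψ ha hab hb hlt
      have hsT : s ∈ Set.Icc 0 T := ⟨ha.trans hs.1, hs.2.trans hb⟩
      have hsub : ∫ s in Set.Ioc a b, {s | ε ≤ z s}.indicator g s = 0 := by
        refine setIntegral_eq_zero_of_forall_eq_zero fun x hx => Set.indicator_of_notMem ?_ _
        have hd := hδz x ⟨ha.trans hx.1.le, hx.2.trans hb⟩ s hsT (by
          rw [Real.dist_eq, abs_le]; constructor <;> linarith [hx.1, hx.2, hs.1, hs.2])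
        rw [hzψ s hsT, hs0, Real.dist_eq, sub_zero] at hd
        simp only [Set.mem_ofPred_eq, not_le]
        linarith [le_abs_self (z x)]
      rw [hsub]
      linarith [skorokhod_sub_le hψ hW hinc' ha hab hb]
    · have h1 := hinc a b ha hab hb
      have h2 : ∫ s in Set.Ioc a b, {s | ε ≤ z s}.indicator g s ≤ ∫ s in Set.Ioc a b, g s := by
        have hsub : Set.Ioc a b ⊆ Set.Icc 0 T := fun x hx => ⟨ha.trans hx.1.le, hx.2.trans hb⟩
        exact setIntegral_mono (hind.mono_set hsub) (hg.mono_set hsub)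
          fun x => Set.indicator_le_self' (fun _ _ => hg0 _) x
      have h4 := skorokhod_add_min ψ b
      have h5 := skorokhod_add_min ψ a
      linarith
  obtain ⟨N, hN⟩ := exists_nat_gt ((T - τ) / δ)
  have hN0 : (0 : ℝ) < N := lt_of_le_of_lt (div_nonneg (sub_nonneg.2 hτ.2) hδ.le) hN
  set h : ℝ := (T - τ) / N with hh
  have hh0 : 0 ≤ h := div_nonneg (sub_nonneg.2 hτ.2) hN0.le
  have hNh : N * h = T - τ := by rw [hh]; field_simp
  have hhδ : h ≤ δ := by
    rw [div_lt_iff₀ hδ] at hN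
    rw [hh, div_le_iff₀ hN0]; linarith
  have hind : ∀ n : ℕ, n ≤ N → 2 * ∫ s in Set.Ioc τ (τ + n * h), {s | ε ≤ z s}.indicator g s ≤
      z τ - z (τ + n * h) + (W (τ + n * h) - W τ) := by
    intro n
    induction n with
    | zero => simp
    | succ n ih =>
      intro hn
      have h1 := ih (n.le_succ.trans hn)
      have hx0 : 0 ≤ τ + n * h := add_nonneg hτ.1 (mul_nonneg n.cast_nonneg hh0)
      have hxx : τ + n * h ≤ τ + (n + 1 : ℕ) * h := by push_cast; nlinarith
      have hxT : τ + (n + 1 : ℕ) * h ≤ T := by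
        have : ((n + 1 : ℕ) : ℝ) * h ≤ N * h :=
          mul_le_mul_of_nonneg_right (by exact_mod_cast hn) hh0
        linarith
      have hτx : τ ≤ τ + n * h := le_add_of_nonneg_right (mul_nonneg n.cast_nonneg hh0)
      have h2 := hstep _ _ hx0 hxx hxT (by push_cast; linarith)
      have e1 := setIntegral_Icc_sub_setIntegral_Icc hind hτ.1 hτx (hxx.trans hxT)
      have e2 := setIntegral_Icc_sub_setIntegral_Icc hind hτ.1 (hτx.trans hxx) hxT
      have e3 := setIntegral_Icc_sub_setIntegral_Icc hind hx0 hxx hxT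
      linarith
  have := hind N le_rfl
  rwa [hNh, add_sub_cancel] at this

lemma two_mul_setIntegral_le_of_skorokhod (hψ : ContinuousOn ψ (Set.Icc 0 T)) {z W g : ℝ → ℝ}
    (hz : Continuous z) (hzψ : ∀ t ∈ Set.Icc 0 T, z t = skorokhod ψ t)
    (hW : MonotoneOn W (Set.Icc 0 T)) (hg0 : ∀ s, 0 ≤ g s) (hg : IntegrableOn g (Set.Icc 0 T))
    (hvan : ∀ᵐ s ∂volume.restrict (Set.Icc 0 T), z s ≤ 0 → g s = 0)
    (hinc : ∀ a b, 0 ≤ a → a ≤ b → b ≤ T →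
      ψ b - ψ a + 2 * ∫ s in Set.Ioc a b, g s ≤ W b - W a) {τ : ℝ} (hτ : τ ∈ Set.Icc 0 T) :
    2 * ∫ s in Set.Ioc τ T, g s ≤ z τ + (W T - W τ) := by
  have hsub : Set.Ioc τ T ⊆ Set.Icc 0 T := fun x hx => ⟨hτ.1.trans hx.1.le, hx.2⟩
  have hzT : 0 ≤ z T := by
    have hT : T ∈ Set.Icc 0 T := ⟨hτ.1.trans hτ.2, le_rfl⟩
    rw [hzψ T hT]
    exact skorokhod_nonneg hψ hT
  have hlim : Tendsto (fun n : ℕ => ∫ s in Set.Ioc τ T,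
      {s | 1 / ((n : ℝ) + 1) ≤ z s}.indicator g s) atTop (𝓝 (∫ s in Set.Ioc τ T, g s)) := by
    refine tendsto_integral_of_dominated_convergence g
      (fun n => ((hg.mono_set hsub).indicator
        (measurableSet_le measurable_const hz.measurable)).aestronglyMeasurable)
      (hg.mono_set hsub) (fun n => Eventually.of_forall fun s => ?_) ?_
    · rw [Real.norm_of_nonneg (Set.indicator_nonneg (fun _ _ => hg0 _) _)]
      exact Set.indicator_le_self' (fun _ _ => hg0 _) s
    · filter_upwards [ae_restrict_of_ae_restrict_of_subset hsub hvan] with s hs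
      rcases le_or_gt (z s) 0 with h | h
      · have : ∀ n : ℕ, {s | 1 / ((n : ℝ) + 1) ≤ z s}.indicator g s = g s := fun n => by
          rw [hs h, Set.indicator_apply, hs h, ite_self]
        simp_rw [this]
        exact tendsto_const_nhds
      · refine tendsto_const_nhds.congr' ?_
        filter_upwards [tendsto_one_div_add_atTop_nhds_zero_nat.eventually (gt_mem_nhds h)] with n hn
        exact (Set.indicator_of_mem (s := {s | 1 / ((n : ℝ) + 1) ≤ z s}) hn.le g).symm
  refine le_of_tendsto' (hlim.const_mul 2) fun n => ?_
  have := two_mul_setIntegral_indicator_le hψ hz hzψ hW hg0 hg hinc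
    (ε := 1 / ((n : ℝ) + 1)) (by positivity) hτ
  linarith

end Skorokhod

/-! ### Increments of a path driven by a flux -/

section Flux

variable {T : ℝ} {p : ℕ → ℝ} {ζ : ℕ → ℝ → ℝ} {ψ : ℝ → ℝ} {g : ℕ → ℝ → ℝ}

lemma IsFlux.setIntegral_nonneg (hg : IsFlux T p ζ ψ g) (k : ℕ) (A : Set ℝ) :
    0 ≤ ∫ s in A, g k s :=
  integral_nonneg (hg.nonneg k)

lemma IsFlux.setIntegral_mono_set (hg : IsFlux T p ζ ψ g) (k : ℕ) {A : Set ℝ}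
    (hA : A ⊆ Set.Icc 0 T) : ∫ s in A, g k s ≤ ∫ s in Set.Icc 0 T, g k s :=
  MeasureTheory.setIntegral_mono_set (hg.int k) (Eventually.of_forall (hg.nonneg k))
    hA.eventuallyLE

lemma IsFlux.setIntegral_le (hg : IsFlux T p ζ ψ g) (h : PathReg p ζ) (hT : 0 ≤ T) {k : ℕ}
    (hk : 1 ≤ k) {A : Set ℝ} (hA : A ⊆ Set.Icc 0 T) : ∫ s in A, g k s ≤ p k := by
  have h1 := hg.zeta T ⟨hT, le_rfl⟩ k hk
  have h2 := h.nonneg k T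
  exact (hg.setIntegral_mono_set k hA).trans (by linarith)

lemma abs_natCast_sub_two_le {k : ℕ} (hk : 1 ≤ k) : |(k : ℝ) - 2| ≤ k := by
  have : (1 : ℝ) ≤ k := by exact_mod_cast hk
  rw [abs_le]; constructor <;> linarith

lemma IsFlux.weight_le (hg : IsFlux T p ζ ψ g) (h : PathReg p ζ) (hT : 0 ≤ T) {k : ℕ}
    (hk : 1 ≤ k) {A : Set ℝ} (hA : A ⊆ Set.Icc 0 T) :
    |(k : ℝ) - 2| * ∫ s in A, g k s ≤ k * p k :=
  mul_le_mul (abs_natCast_sub_two_le hk) (hg.setIntegral_le h hT hk hA)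
    (hg.setIntegral_nonneg k A) k.cast_nonneg

lemma IsFlux.summable_abs (hg : IsFlux T p ζ ψ g) (h : PathReg p ζ) (hT : 0 ≤ T)
    (hp : Summable fun k : ℕ => (k : ℝ) * p k) {A : Set ℝ} (hA : A ⊆ Set.Icc 0 T) :
    Summable fun k : ℕ => |(k : ℝ) - 2| * ∫ s in A, g k s := by
  refine (summable_nat_add_iff 1).1 (Summable.of_nonneg_of_le (fun k => ?_) (fun k => ?_)
    ((summable_nat_add_iff 1).2 hp))
  · exact mul_nonneg (abs_nonneg _) (hg.setIntegral_nonneg _ A)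
  · exact hg.weight_le h hT (Nat.le_add_left 1 k) hA

lemma IsFlux.summable (hg : IsFlux T p ζ ψ g) (h : PathReg p ζ) (hT : 0 ≤ T)
    (hp : Summable fun k : ℕ => (k : ℝ) * p k) {A : Set ℝ} (hA : A ⊆ Set.Icc 0 T) :
    Summable fun k : ℕ => ((k : ℝ) - 2) * ∫ s in A, g k s := by
  refine Summable.of_norm_bounded (hg.summable_abs h hT hp hA) fun k => ?_
  rw [norm_mul, Real.norm_eq_abs, Real.norm_of_nonneg (hg.setIntegral_nonneg k A)]

lemma IsFlux.zeta_sub (hg : IsFlux T p ζ ψ g) {k : ℕ} (hk : 1 ≤ k) {a b : ℝ} (ha : 0 ≤ a)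
    (hab : a ≤ b) (hb : b ≤ T) : ζ k a - ζ k b = ∫ s in Set.Ioc a b, g k s := by
  rw [← setIntegral_Icc_sub_setIntegral_Icc (hg.int k) ha hab hb,
    hg.zeta a ⟨ha, hab.trans hb⟩ k hk, hg.zeta b ⟨ha.trans hab, hb⟩ k hk]
  ring

lemma IsFlux.psi_sub (hg : IsFlux T p ζ ψ g) (h : PathReg p ζ)
    (hp : Summable fun k : ℕ => (k : ℝ) * p k) {a b : ℝ} (ha : 0 ≤ a)
    (hab : a ≤ b) (hb : b ≤ T) :
    ψ b - ψ a = ∑' k : ℕ, ((k : ℝ) - 2) * ∫ s in Set.Ioc a b, g k s := by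
  have hT : 0 ≤ T := ha.trans (hab.trans hb)
  rw [hg.psi a ⟨ha, hab.trans hb⟩, hg.psi b ⟨ha.trans hab, hb⟩, ← Summable.tsum_sub
    (hg.summable h hT hp (Set.Icc_subset_Icc_right hb))
    (hg.summable h hT hp (Set.Icc_subset_Icc_right (hab.trans hb)))]
  refine tsum_congr fun k => ?_
  rw [← setIntegral_Icc_sub_setIntegral_Icc (hg.int k) ha hab hb]
  ring

lemma Ioc_subset_Icc_of_le {a b T : ℝ} (ha : 0 ≤ a) (hb : b ≤ T) :
    Set.Ioc a b ⊆ Set.Icc 0 T := fun _ hx => ⟨ha.trans hx.1.le, hx.2.trans hb⟩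

lemma IsFlux.abs_psi_sub_le (hg : IsFlux T p ζ ψ g) (h : PathReg p ζ)
    (hp : Summable fun k : ℕ => (k : ℝ) * p k) {a b : ℝ} (ha : 0 ≤ a)
    (hab : a ≤ b) (hb : b ≤ T) :
    |ψ b - ψ a| ≤ ∑' k : ℕ, |(k : ℝ) - 2| * ∫ s in Set.Ioc a b, g k s := by
  have hT : 0 ≤ T := ha.trans (hab.trans hb)
  have hsub := Ioc_subset_Icc_of_le ha hb
  rw [hg.psi_sub h hp ha hab hb, ← Real.norm_eq_abs]
  refine tsum_of_norm_bounded (hg.summable_abs h hT hp hsub).hasSum fun k => ?_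
  rw [norm_mul, Real.norm_eq_abs, Real.norm_of_nonneg (hg.setIntegral_nonneg k _)]

/-- The zeroth flux is determined by the driver and the other fluxes. -/
lemma IsFlux.integral_zero (hg : IsFlux T p ζ ψ g) (h : PathReg p ζ)
    (hp : Summable fun k : ℕ => (k : ℝ) * p k) {t : ℝ} (ht : t ∈ Set.Icc 0 T) :
    ∫ s in Set.Icc 0 t, g 0 s =
      (∑' k : ℕ, (((k + 1 : ℕ) : ℝ) - 2) * (p (k + 1) - ζ (k + 1) t) - ψ t) / 2 := by
  rw [hg.psi t ht, (hg.summable h (ht.1.trans ht.2) hp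
    (Set.Icc_subset_Icc_right ht.2)).tsum_eq_zero_add]
  have : ∀ k : ℕ, ∫ s in Set.Icc 0 t, g (k + 1) s = p (k + 1) - ζ (k + 1) t := fun k => by
    rw [hg.zeta t ht (k + 1) (Nat.le_add_left 1 k)]; ring
  simp_rw [this]
  push_cast
  ring

lemma IsFlux.tsum_zeta_sub (hg : IsFlux T p ζ ψ g) (h : PathReg p ζ)
    (hp : Summable fun k : ℕ => (k : ℝ) * p k) {a b : ℝ} (ha : 0 ≤ a)
    (hab : a ≤ b) (hb : b ≤ T) :
    HasSum (fun k : ℕ => (k : ℝ) * ∫ s in Set.Ioc a b, g k s)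
      (∑' k : ℕ, (k : ℝ) * ζ k a - ∑' k : ℕ, (k : ℝ) * ζ k b) := by
  refine ((h.summable hp a).hasSum.sub (h.summable hp b).hasSum).congr_fun fun k => ?_
  rcases Nat.eq_zero_or_pos k with rfl | hk
  · simp
  · rw [← hg.zeta_sub hk ha hab hb]; ring

lemma IsFlux.two_mul_integral_zero_le (hg : IsFlux T p ζ ψ g) (h : PathReg p ζ)
    (hp : Summable fun k : ℕ => (k : ℝ) * p k) (hψ : ContinuousOn ψ (Set.Icc 0 T))
    (hz : ∀ t ∈ Set.Icc 0 T, ζ 0 t = skorokhod ψ t) {τ : ℝ} (hτ : τ ∈ Set.Icc 0 T) :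
    2 * ∫ s in Set.Ioc τ T, g 0 s ≤ rtot fun j => ζ j τ := by
  have hT : 0 ≤ T := hτ.1.trans hτ.2
  have key := two_mul_setIntegral_le_of_skorokhod (W := fun t => - ∑' k : ℕ, (k : ℝ) * ζ k t)
    hψ (h.cont 0) hz ?_ (hg.nonneg 0) (hg.int 0) ?_ ?_ hτ
  · have h1 : 0 ≤ ∑' k : ℕ, (k : ℝ) * ζ k T :=
      tsum_nonneg fun k => mul_nonneg k.cast_nonneg (h.nonneg k T)
    unfold rtot
    linarith [le_max_left (ζ 0 τ) 0]
  · intro a ha b hb hab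
    have h1 := (hg.tsum_zeta_sub h hp ha.1 hab hb.2).nonneg fun k =>
      mul_nonneg k.cast_nonneg (hg.setIntegral_nonneg k _)
    dsimp only
    linarith
  · filter_upwards [hg.vanish 0] with s hs h0
    exact hs (rcoord_zero_of_nonpos h0)
  · intro a b ha hab hb
    have h1 := hg.tsum_zeta_sub h hp ha hab hb
    have h2 := (hg.summable h hT hp (Ioc_subset_Icc_of_le ha hb)).hasSum
    rw [← hg.psi_sub h hp ha hab hb] at h2
    have h3 := h1.sub h2
    have h4 := le_hasSum h3 0 fun k _ => by
      have := hg.setIntegral_nonneg k (Set.Ioc a b)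
      linarith
    simp only [Nat.cast_zero] at h4
    linarith

/-- Fluxes of bounded cost are uniformly integrable, jointly in the index. -/
lemma exists_forall_isFlux_le (hT : 0 ≤ T) (hp : Summable fun k : ℕ => (k : ℝ) * p k)
    {M ε : ℝ} (hM : 0 ≤ M) (hε : 0 < ε) :
    ∃ δ : ℝ, 0 < δ ∧ ∀ (ζ : ℕ → ℝ → ℝ) (ψ : ℝ → ℝ) (g : ℕ → ℝ → ℝ), PathReg p ζ →
      IsFlux T p ζ ψ g →
      (∀ k, fluxCost T ζ g k ≤ ENNReal.ofReal M) → ∀ A ⊆ Set.Icc 0 T,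
      volume A < ENNReal.ofReal δ →
      (∀ k, ∫ s in A, g k s ≤ ε) ∧ ∑' k : ℕ, |(k : ℝ) - 2| * ∫ s in A, g k s ≤ ε := by
  have hp1 : Summable fun k : ℕ => ((k + 1 : ℕ) : ℝ) * p (k + 1) :=
    (summable_nat_add_iff (f := fun k : ℕ => (k : ℝ) * p k) 1).2 hp
  obtain ⟨N, hN⟩ : ∃ N : ℕ, ∑' k : ℕ, ((k + 1 : ℕ) : ℝ) * p (k + 1) - ε / 2 <
      ∑ k ∈ Finset.range N, ((k + 1 : ℕ) : ℝ) * p (k + 1) :=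
    (hp1.tendsto_sum_tsum_nat.eventually (lt_mem_nhds (sub_lt_self _ (half_pos hε)))).exists
  set C : ℝ := ∑ k ∈ Finset.range (N + 1), |(k : ℝ) - 2| with hC
  have hC0 : 0 ≤ C := Finset.sum_nonneg fun _ _ => abs_nonneg _
  obtain ⟨δ, hδ, hδ'⟩ := exists_forall_setIntegral_le hM
    (ε := ε / 2 / (C + 1)) (by positivity)
  refine ⟨δ, hδ, fun ζ ψ g h hg hcost A hA hvol => ?_⟩
  have hsmall : ∀ k, ∫ s in A, g k s ≤ ε / 2 / (C + 1) := fun k => by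
    have := hδ' (volume.restrict (Set.Icc 0 T)) (fun s => rcoord (fun j => ζ j s) k) (g k)
      (fun s => h.rcoord_nonneg s k) (fun s => h.rcoord_le_one hp s k) (hg.nonneg k) (hg.int k)
      (hg.vanish k) (hcost k) A ((Measure.restrict_apply_le _ _).trans_lt hvol)
    rwa [Measure.restrict_restrict_of_subset hA] at this
  refine ⟨fun k => (hsmall k).trans ?_, ?_⟩
  · rw [div_le_iff₀ (by positivity)]
    nlinarith
  have hs := hg.summable_abs h hT hp hA
  rw [← hs.sum_add_tsum_nat_add (N + 1)]
  have h1 : ∑ k ∈ Finset.range (N + 1), |(k : ℝ) - 2| * ∫ s in A, g k s ≤ ε / 2 := by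
    calc _ ≤ ∑ k ∈ Finset.range (N + 1), |(k : ℝ) - 2| * (ε / 2 / (C + 1)) :=
          Finset.sum_le_sum fun k _ => mul_le_mul_of_nonneg_left (hsmall k) (abs_nonneg _)
      _ = C * (ε / 2 / (C + 1)) := by rw [← Finset.sum_mul]
      _ ≤ ε / 2 := by
        rw [mul_div_assoc', div_le_iff₀ (by positivity)]
        nlinarith
  have h2 : ∑' k : ℕ, |((k + (N + 1) : ℕ) : ℝ) - 2| * ∫ s in A, g (k + (N + 1)) s ≤
      ∑' k : ℕ, ((k + (N + 1) : ℕ) : ℝ) * p (k + (N + 1)) :=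
    Summable.tsum_le_tsum (fun k => hg.weight_le h hT (by omega) hA)
      ((summable_nat_add_iff (N + 1)).2 hs)
      ((summable_nat_add_iff (f := fun k : ℕ => (k : ℝ) * p k) (N + 1)).2 hp)
  have h3 := hp1.sum_add_tsum_nat_add N
  simp only [add_assoc] at h3 hN
  linarith

end Flux

/-! ### Limits of fluxes -/

lemma ENNReal.tsum_liminf_le {a : ℕ → ℕ → ℝ≥0∞} :
    ∑' k, liminf (fun n => a n k) atTop ≤ liminf (fun n => ∑' k, a n k) atTop := by
  simp_rw [← lintegral_count]
  exact lintegral_liminf_le fun n => measurable_from_top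

section Limit

variable {T : ℝ} {p : ℕ → ℝ} {ζ : ℕ → ℝ → ℝ} {ψ : ℝ → ℝ} {ζs : ℕ → ℕ → ℝ → ℝ}
  {ψs : ℕ → ℝ → ℝ} {gs : ℕ → ℕ → ℝ → ℝ}

lemma exists_isFlux_of_tendsto_integral (h : PathReg p ζ)
    (hp : Summable fun k : ℕ => (k : ℝ) * p k) (hs : ∀ n, PathReg p (ζs n))
    (hf : ∀ n, IsFlux T p (ζs n) (ψs n) (gs n))
    (hζ : ∀ k s, Tendsto (fun n => ζs n k s) atTop (𝓝 (ζ k s)))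
    (hψ : ∀ t ∈ Set.Icc 0 T, Tendsto (fun n => ψs n t) atTop (𝓝 (ψ t))) :
    ∃ B : ℕ → ℝ → ℝ, (∀ k, ∀ t ∈ Set.Icc 0 T,
        Tendsto (fun n => ∫ s in Set.Icc 0 t, gs n k s) atTop (𝓝 (B k t))) ∧
      (∀ t ∈ Set.Icc 0 T, ψ t = ∑' k : ℕ, ((k : ℝ) - 2) * B k t) ∧
      ∀ t ∈ Set.Icc 0 T, ∀ k, 1 ≤ k → ζ k t = p k - B k t := by
  set B : ℕ → ℝ → ℝ := fun k t => if k = 0 then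
    (∑' j : ℕ, (((j + 1 : ℕ) : ℝ) - 2) * (p (j + 1) - ζ (j + 1) t) - ψ t) / 2
    else p k - ζ k t with hB
  have hbound : ∀ {ξ : ℕ → ℝ → ℝ}, PathReg p ξ → ∀ t k,
      ‖(((k + 1 : ℕ) : ℝ) - 2) * (p (k + 1) - ξ (k + 1) t)‖ ≤ ((k + 1 : ℕ) : ℝ) * p (k + 1) := by
    intro ξ hξ t k
    have h1 := hξ.le (k + 1) (Nat.le_add_left 1 k) t
    have h2 := hξ.nonneg (k + 1) t
    rw [norm_mul, Real.norm_eq_abs, Real.norm_of_nonneg (sub_nonneg.2 h1)]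
    exact mul_le_mul (abs_natCast_sub_two_le (Nat.le_add_left 1 k)) (by linarith)
      (sub_nonneg.2 h1) (Nat.cast_nonneg _)
  have hp1 : Summable fun k : ℕ => ((k + 1 : ℕ) : ℝ) * p (k + 1) :=
    (summable_nat_add_iff (f := fun k : ℕ => (k : ℝ) * p k) 1).2 hp
  refine ⟨B, fun k t ht => ?_, fun t ht => ?_, fun t ht k hk => ?_⟩
  · rcases Nat.eq_zero_or_pos k with rfl | hk
    · simp_rw [(hf _).integral_zero (hs _) hp ht]
      simp only [hB, if_true]
      refine Tendsto.div_const (Tendsto.sub ?_ (hψ t ht)) 2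
      exact tendsto_tsum_of_dominated_convergence hp1
        (fun k => (tendsto_const_nhds.sub (hζ (k + 1) t)).const_mul _)
        (Eventually.of_forall fun n k => hbound (hs n) t k)
    · have : ∀ n, ∫ s in Set.Icc 0 t, gs n k s = p k - ζs n k t := fun n => by
        rw [(hf n).zeta t ht k hk]; ring
      simp only [this, hB, if_neg (Nat.pos_iff_ne_zero.1 hk)]
      exact tendsto_const_nhds.sub (hζ k t)
  · have hsum : Summable fun k : ℕ => ((k : ℝ) - 2) * B k t := by
      refine (summable_nat_add_iff 1).1 (Summable.of_norm_bounded hp1 fun k => ?_)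
      simpa [hB] using hbound h t k
    rw [hsum.tsum_eq_zero_add]
    simp only [hB, if_true, Nat.add_eq_zero_iff, one_ne_zero, and_false, if_false]
    push_cast
    ring
  · simp only [hB, if_neg (Nat.pos_iff_ne_zero.1 hk)]
    ring

/-- When the limiting path dies out, so do the limiting fluxes. -/
lemma ae_eq_zero_of_rtot_nonpos (h : PathReg p ζ)
    (hp : Summable fun k : ℕ => (k : ℝ) * p k) (hs : ∀ n, PathReg p (ζs n))
    (hf : ∀ n, IsFlux T p (ζs n) (ψs n) (gs n))
    (hψc : ∀ n, ContinuousOn (ψs n) (Set.Icc 0 T))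
    (hz : ∀ n, ∀ t ∈ Set.Icc 0 T, ζs n 0 t = skorokhod (ψs n) t)
    (hζ : ∀ k s, Tendsto (fun n => ζs n k s) atTop (𝓝 (ζ k s)))
    {k : ℕ} {g : ℝ → ℝ} (hg0 : ∀ s, 0 ≤ g s) (hgi : IntegrableOn g (Set.Icc 0 T))
    (hset : ∀ A, MeasurableSet A → A ⊆ Set.Icc 0 T →
      Tendsto (fun n => ∫ s in A, gs n k s) atTop (𝓝 (∫ s in A, g s))) :
    ∀ᵐ s ∂volume.restrict (Set.Icc 0 T), ¬ 0 < rtot (fun j => ζ j s) → g s = 0 := by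
  set Z : Set ℝ := {s | rtot (fun j => ζ j s) ≤ 0} ∩ Set.Icc 0 T with hZ
  have hZc : IsCompact Z := isCompact_Icc.inter_left
    (isClosed_le (h.continuous_rtot hp) continuous_const)
  rw [ae_restrict_iff' measurableSet_Icc]
  rcases Z.eq_empty_or_nonempty with hZe | hZn
  · refine Eventually.of_forall fun s hsT hsr => ?_
    have : s ∈ Z := ⟨not_lt.1 hsr, hsT⟩
    simp [hZe] at this
  set τ := sInf Z
  have hτZ : τ ∈ Z := hZc.sInf_mem hZn
  obtain ⟨hτr, hτ⟩ := hτZ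
  have hτ0 : rtot (fun j => ζ j τ) = 0 := le_antisymm hτr (h.rtot_nonneg τ)
  have hsub := Ioc_subset_Icc_of_le hτ.1 (le_refl T)
  have hlim := hset _ measurableSet_Ioc hsub
  have hzero : ∫ s in Set.Ioc τ T, g s = 0 := by
    refine le_antisymm ?_ (integral_nonneg hg0)
    rcases Nat.eq_zero_or_pos k with rfl | hk
    · have h1 := le_of_tendsto_of_tendsto' (hlim.const_mul 2) (PathReg.tendsto_rtot hs hp
        fun k => hζ k τ) fun n => (hf n).two_mul_integral_zero_le (hs n) hp (hψc n) (hz n) hτ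
      linarith
    · have h1 : Tendsto (fun n => ∫ s in Set.Ioc τ T, gs n k s) atTop (𝓝 (ζ k τ - ζ k T)) := by
        simp_rw [← (hf _).zeta_sub hk hτ.1 hτ.2 le_rfl]
        exact (hζ k τ).sub (hζ k T)
      rw [tendsto_nhds_unique hlim h1]
      have h2 := h.mul_le_rtot hp τ k
      have h3 : (1 : ℝ) ≤ k := by exact_mod_cast hk
      have h4 := h.nonneg k T
      have h5 := h.nonneg k τ
      nlinarith
  have hae := (setIntegral_eq_zero_iff_of_nonneg_ae (Eventually.of_forall hg0)
    (hgi.mono_set hsub)).1 hzero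
  rw [EventuallyEq, ae_restrict_iff' measurableSet_Ioc] at hae
  filter_upwards [hae, compl_mem_ae_iff.2 (measure_singleton τ)] with s h1 h2 hsT hsr
  refine h1 ⟨lt_of_le_of_ne (csInf_le hZc.bddBelow ⟨not_lt.1 hsr, hsT⟩) fun he => h2 he.symm, hsT.2⟩

lemma exists_isFlux_of_tendsto (hT : 0 < T) {M : ℝ} (hM : 0 ≤ M) (h : PathReg p ζ)
    (hp : Summable fun k : ℕ => (k : ℝ) * p k) (hs : ∀ n, PathReg p (ζs n))
    (hf : ∀ n, IsFlux T p (ζs n) (ψs n) (gs n))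
    (hcost : ∀ n, ∑' k, fluxCost T (ζs n) (gs n) k ≤ ENNReal.ofReal M)
    (hψc : ∀ n, ContinuousOn (ψs n) (Set.Icc 0 T))
    (hz : ∀ n, ∀ t ∈ Set.Icc 0 T, ζs n 0 t = skorokhod (ψs n) t)
    (hζ : ∀ k s, Tendsto (fun n => ζs n k s) atTop (𝓝 (ζ k s)))
    (hψ : ∀ t ∈ Set.Icc 0 T, Tendsto (fun n => ψs n t) atTop (𝓝 (ψ t))) :
    ∃ g, IsFlux T p ζ ψ g ∧ ∑' k, fluxCost T ζ g k ≤ ENNReal.ofReal M := by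
  obtain ⟨B, hB, hBψ, hBζ⟩ := exists_isFlux_of_tendsto_integral h hp hs hf hζ hψ
  have hcostk : ∀ n k, fluxCost T (ζs n) (gs n) k ≤ ENNReal.ofReal M := fun n k =>
    (ENNReal.le_tsum k).trans (hcost n)
  have hex : ∀ k, ∃ g : ℝ → ℝ, Measurable g ∧ (∀ s, 0 ≤ g s) ∧ IntegrableOn g (Set.Icc 0 T) ∧
      ∀ A, MeasurableSet A → Tendsto (fun n => ∫ s in A, gs n k s ∂(volume.restrict (Set.Icc 0 T)))
        atTop (𝓝 (∫ s in A, g s ∂(volume.restrict (Set.Icc 0 T)))) := fun k => by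
    refine exists_setwise_limit hT (fun n => (hf n).nonneg k) (fun n => (hf n).int k) ?_ (hB k)
    intro ε hε
    obtain ⟨δ, hδ, H⟩ := exists_forall_isFlux_le hT.le hp hM hε
    refine ⟨δ, hδ, fun n A hA hvol => ?_⟩
    rw [Measure.restrict_apply hA] at hvol
    rw [Measure.restrict_restrict hA]
    exact (H _ _ _ (hs n) (hf n) (hcostk n) _ Set.inter_subset_right hvol).1 k
  choose g hgm hg0 hgi hgset using hex
  have hgset' : ∀ k A, MeasurableSet A → A ⊆ Set.Icc 0 T →
      Tendsto (fun n => ∫ s in A, gs n k s) atTop (𝓝 (∫ s in A, g k s)) := fun k A hA hsub => by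
    have := hgset k A hA
    rwa [Measure.restrict_restrict_of_subset hsub] at this
  have hgB : ∀ k, ∀ t ∈ Set.Icc 0 T, ∫ s in Set.Icc 0 t, g k s = B k t := fun k t ht =>
    tendsto_nhds_unique (hgset' k _ measurableSet_Icc (Set.Icc_subset_Icc_right ht.2)) (hB k t ht)
  have hdead : ∀ k, ∀ᵐ s ∂volume.restrict (Set.Icc 0 T),
      ¬ 0 < rtot (fun j => ζ j s) → g k s = 0 := fun k =>
    ae_eq_zero_of_rtot_nonpos h hp hs hf hψc hz hζ (hg0 k) (hgi k) (hgset' k)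
  set S : Set ℝ := {s | 0 < rtot (fun j => ζ j s)} with hS
  have hSm : MeasurableSet S := measurableSet_lt measurable_const (h.continuous_rtot hp).measurable
  set ν : Measure ℝ := (volume.restrict (Set.Icc 0 T)).restrict S with hν
  have hle : ∀ k, liminf (fun n => ∫⁻ s, ENNReal.ofReal
      (perspCost (rcoord (fun j => ζs n j s) k) (gs n k s)) ∂ν) atTop ≤
      liminf (fun n => fluxCost T (ζs n) (gs n) k) atTop := fun k =>
    liminf_le_liminf (Eventually.of_forall fun n => setLIntegral_le_lintegral _ _)
  have hfin : ∀ k, liminf (fun n => ∫⁻ s, ENNReal.ofReal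
      (perspCost (rcoord (fun j => ζs n j s) k) (gs n k s)) ∂ν) atTop ≠ ⊤ := fun k => by
    refine ne_top_of_le_ne_top (ENNReal.ofReal_ne_top (r := M)) ((hle k).trans
      ((liminf_le_liminf (Eventually.of_forall fun n => hcostk n k)).trans ?_))
    simp
  have hgν : ∀ k, Integrable (g k) ν := fun k => Integrable.restrict (hgi k)
  have hgsν : ∀ n k, Integrable (gs n k) ν := fun n k => Integrable.restrict ((hf n).int k)
  have hri : ∀ k, Integrable (fun s => rcoord (fun j => ζ j s) k) ν := fun k => by
    refine Integrable.of_bound (h.measurable_rcoord hp k).aestronglyMeasurable 1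
      (Eventually.of_forall fun s => ?_)
    rw [Real.norm_of_nonneg (h.rcoord_nonneg s k)]
    exact h.rcoord_le_one hp s k
  have hvan : ∀ k n, ∀ᵐ s ∂ν, rcoord (fun j => ζs n j s) k = 0 → gs n k s = 0 := fun k n =>
    ae_restrict_of_ae ((hf n).vanish k)
  have hrlim : ∀ k, ∀ᵐ s ∂ν, Tendsto (fun n => rcoord (fun j => ζs n j s) k) atTop
      (𝓝 (rcoord (fun j => ζ j s) k)) := fun k => by
    filter_upwards [ae_restrict_mem hSm] with s hsS
    exact PathReg.tendsto_rcoord hs hp (fun k => hζ k s) hsS k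
  have hνset : ∀ k A, MeasurableSet A → Tendsto (fun n => ∫ s in A, gs n k s ∂ν) atTop
      (𝓝 (∫ s in A, g k s ∂ν)) := fun k A hA => by
    rw [hν, Measure.restrict_restrict hA]
    exact hgset k _ (hA.inter hSm)
  have hvanS : ∀ k, ∀ᵐ s ∂ν, rcoord (fun j => ζ j s) k = 0 → g k s = 0 := fun k =>
    ae_eq_zero_of_liminf_ne_top (fun n => (hs n).measurable_rcoord hp k)
      (fun n s => (hs n).rcoord_nonneg s k) (fun n s => (hs n).rcoord_le_one hp s k)
      (fun n => (hf n).nonneg k) (fun n => hgsν n k)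
      (h.measurable_rcoord hp k) (hri k) (hg0 k) (hgν k) (hvan k) (hrlim k)
      (hνset k) (hfin k)
  have hcostS : ∀ k, fluxCost T ζ g k ≤ liminf (fun n => fluxCost T (ζs n) (gs n) k) atTop := by
    intro k
    refine le_trans ?_ ((lintegral_perspCost_le_liminf (fun n => (hs n).measurable_rcoord hp k)
      (fun n s => (hs n).rcoord_nonneg s k) (fun n s => (hs n).rcoord_le_one hp s k)
      (fun n => (hf n).nonneg k) (fun n => hgsν n k)
      (h.measurable_rcoord hp k) (hri k) (fun s => h.rcoord_nonneg s k) (hgm k) (hg0 k)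
      (hgν k) (hvan k) (hrlim k) (hνset k) (hfin k)).trans (hle k))
    unfold fluxCost
    rw [← lintegral_add_compl _ hSm]
    rw [setLIntegral_eq_zero hSm.compl fun s hsS => ?_, add_zero]
    have h0 : rcoord (fun j => ζ j s) k = 0 := if_neg hsS
    simp [h0, perspCost]
  refine ⟨g, ⟨hgm, hg0, hgi, fun k => ?_, fun t ht => ?_, fun t ht k hk => ?_⟩, ?_⟩
  · have h1 := hvanS k
    rw [hν, ae_restrict_iff' hSm] at h1
    filter_upwards [h1, hdead k] with s h1 h2 h3
    by_cases hsS : s ∈ S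
    · exact h1 hsS h3
    · exact h2 hsS
  · simp_rw [hgB _ t ht]
    exact hBψ t ht
  · rw [hgB k t ht]
    exact hBζ t ht k hk
  · refine (ENNReal.tsum_le_tsum hcostS).trans (ENNReal.tsum_liminf_le.trans ?_)
    refine (liminf_le_liminf (Eventually.of_forall hcost)).trans ?_
    simp

end Limit

/-! ### Regularity of controlled paths -/

section Regularity

variable {T : ℝ} {p : ℕ → ℝ} {ζ : ℕ → ℝ → ℝ} {ψ : ℝ → ℝ} {g : ℕ → ℝ → ℝ}

lemma IsFlux.absCont (hT : 0 ≤ T) {M : ℝ} (hM : 0 ≤ M) (h : PathReg p ζ)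
    (hp : Summable fun k : ℕ => (k : ℝ) * p k) (hg : IsFlux T p ζ ψ g)
    (hcost : ∀ k, fluxCost T ζ g k ≤ ENNReal.ofReal M) :
    AbsCont ψ 0 T ∧ ∀ k, 1 ≤ k → AbsCont (ζ k) 0 T := by
  have key : ∀ ε > 0, ∃ δ > 0, ∀ n : ℕ, ∀ I : Fin n → ℝ × ℝ,
      (∀ i, (I i).1 ∈ Set.Icc 0 T ∧ (I i).2 ∈ Set.Icc 0 T ∧ (I i).1 ≤ (I i).2) →
      (∀ i j, i ≠ j → Disjoint (Set.Ioo (I i).1 (I i).2) (Set.Ioo (I j).1 (I j).2)) →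
      (∑ i, ((I i).2 - (I i).1)) < δ →
      (∑ i, |ψ (I i).2 - ψ (I i).1|) < ε ∧
        ∀ k, 1 ≤ k → (∑ i, |ζ k (I i).2 - ζ k (I i).1|) < ε := by
    intro ε hε
    obtain ⟨δ, hδ, H⟩ := exists_forall_isFlux_le hT hp hM (half_pos hε)
    refine ⟨δ, hδ, fun n I hI hdisj hlen => ?_⟩
    have hsub : ∀ i, Set.Ioo (I i).1 (I i).2 ⊆ Set.Icc 0 T := fun i s hs =>
      ⟨(hI i).1.1.trans hs.1.le, hs.2.le.trans (hI i).2.1.2⟩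
    have hvol : volume (⋃ i, Set.Ioo (I i).1 (I i).2) < ENNReal.ofReal δ := by
      refine (measure_iUnion_fintype_le _ _).trans_lt ?_
      simp_rw [Real.volume_Ioo]
      rw [← ENNReal.ofReal_sum_of_nonneg fun i _ => sub_nonneg.2 (hI i).2.2]
      exact (ENNReal.ofReal_lt_ofReal_iff hδ).2 hlen
    obtain ⟨h1, h2⟩ := H ζ ψ g h hg hcost _ (Set.iUnion_subset hsub) hvol
    have hInt : ∀ k, ∫ s in ⋃ i, Set.Ioo (I i).1 (I i).2, g k s =
        ∑ i, ∫ s in Set.Ioc (I i).1 (I i).2, g k s := fun k => by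
      rw [integral_iUnion_fintype (fun i => measurableSet_Ioo) (fun i j hij => hdisj i j hij)
        fun i => (hg.int k).mono_set (hsub i)]
      simp_rw [integral_Ioc_eq_integral_Ioo]
    simp_rw [hInt] at h1 h2
    refine ⟨lt_of_le_of_lt ?_ (half_lt_self hε), fun k hk =>
      lt_of_le_of_lt (le_trans (le_of_eq ?_) (h1 k)) (half_lt_self hε)⟩
    · refine le_trans (Finset.sum_le_sum fun i _ => hg.abs_psi_sub_le h hp (hI i).1.1 (hI i).2.2
        (hI i).2.1.2) (le_trans (le_of_eq ?_) h2)
      rw [← Summable.tsum_finsetSum fun i _ => hg.summable_abs h hT hp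
        (Ioc_subset_Icc_of_le (hI i).1.1 (hI i).2.1.2)]
      simp_rw [Finset.mul_sum]
    · refine Finset.sum_congr rfl fun i _ => ?_
      rw [abs_sub_comm, hg.zeta_sub hk (hI i).1.1 (hI i).2.2 (hI i).2.1.2,
        abs_of_nonneg (hg.setIntegral_nonneg k _)]
  refine ⟨fun ε hε => ?_, fun k hk ε hε => ?_⟩ <;> obtain ⟨δ, hδ, H⟩ := key ε hε
  · exact ⟨δ, hδ, fun n I h1 h2 h3 => (H n I h1 h2 h3).1⟩
  · exact ⟨δ, hδ, fun n I h1 h2 h3 => (H n I h1 h2 h3).2 k hk⟩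

/-- The Skorokhod map at most doubles the oscillation. -/
lemma abs_skorokhod_sub_le (hψ : ContinuousOn ψ (Set.Icc 0 T)) {a b ε : ℝ} (ha : 0 ≤ a)
    (hab : a ≤ b) (hb : b ≤ T) (hosc : ∀ s ∈ Set.Icc a b, |ψ s - ψ a| ≤ ε) :
    |skorokhod ψ b - skorokhod ψ a| ≤ 2 * ε := by
  have hε : |ψ b - ψ a| ≤ ε := hosc b ⟨hab, le_rfl⟩
  have hm : min (sInf (ψ '' Set.Icc 0 a)) 0 - min (sInf (ψ '' Set.Icc 0 b)) 0 ≤ ε := by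
    rcases (min_sInf_antitone hψ ha hab hb).lt_or_eq with hlt | heq
    · obtain ⟨s, hs, hsm, -⟩ := exists_eq_min_sInf hψ ha hab hb hlt
      have h1 := skorokhod_nonneg hψ (t := a) ⟨ha, hab.trans hb⟩
      have h2 := skorokhod_add_min ψ a
      have h3 := (abs_le.1 (hosc s hs)).1
      linarith
    · rw [heq, sub_self]; exact (abs_nonneg _).trans hε
  have h1 := skorokhod_add_min ψ a
  have h2 := skorokhod_add_min ψ b
  have h3 := min_sInf_antitone hψ ha hab hb
  rw [abs_le] at hε ⊢
  constructor <;> linarith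

lemma abs_skorokhod_sub_skorokhod_le {ψ' : ℝ → ℝ} (hψ : ContinuousOn ψ (Set.Icc 0 T))
    (hψ' : ContinuousOn ψ' (Set.Icc 0 T)) {d t : ℝ} (ht : t ∈ Set.Icc 0 T)
    (hd : ∀ s ∈ Set.Icc 0 T, |ψ s - ψ' s| ≤ d) : |skorokhod ψ t - skorokhod ψ' t| ≤ 2 * d := by
  have key : ∀ {ξ ξ' : ℝ → ℝ}, ContinuousOn ξ (Set.Icc 0 T) →
      (∀ s ∈ Set.Icc 0 T, ξ s - ξ' s ≤ d) →
      sInf (ξ '' Set.Icc 0 t) - sInf (ξ' '' Set.Icc 0 t) ≤ d := by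
    intro ξ ξ' hξ hle
    rw [sub_le_comm]
    refine le_csInf ((Set.nonempty_Icc.2 ht.1).image _) ?_
    rintro _ ⟨s, hs, rfl⟩
    have h1 := csInf_le (bddBelow_image_Icc hξ ht.2) ⟨s, hs, rfl⟩
    have h2 := hle s ⟨hs.1, hs.2.trans ht.2⟩
    linarith
  have h1 : |sInf (ψ '' Set.Icc 0 t) - sInf (ψ' '' Set.Icc 0 t)| ≤ d := by
    refine abs_sub_le_iff.2 ⟨key hψ fun s hs => (abs_sub_le_iff.1 (hd s hs)).1,
      key hψ' fun s hs => (abs_sub_le_iff.1 (hd s hs)).2⟩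
  have h2 : |min (sInf (ψ '' Set.Icc 0 t)) 0 - min (sInf (ψ' '' Set.Icc 0 t)) 0| ≤ d :=
    (abs_min_sub_min_le_max _ _ _ _).trans (by simpa using h1)
  have h3 := hd t ht
  unfold skorokhod
  rw [abs_le] at h2 h3 ⊢
  constructor <;> linarith

lemma exists_forall_isFlux_abs_sub_le (hT : 0 ≤ T)
    (hp : Summable fun k : ℕ => (k : ℝ) * p k) {M ε : ℝ} (hM : 0 ≤ M) (hε : 0 < ε) :
    ∃ δ : ℝ, 0 < δ ∧ ∀ (ζ : ℕ → ℝ → ℝ) (ψ : ℝ → ℝ) (g : ℕ → ℝ → ℝ), PathReg p ζ →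
      IsFlux T p ζ ψ g → (∀ k, fluxCost T ζ g k ≤ ENNReal.ofReal M) →
      ContinuousOn ψ (Set.Icc 0 T) → (∀ t ∈ Set.Icc 0 T, ζ 0 t = skorokhod ψ t) →
      ∀ a b, 0 ≤ a → a ≤ b → b ≤ T → b - a < δ →
        |ψ b - ψ a| ≤ ε ∧ ∀ k, |ζ k b - ζ k a| ≤ ε := by
  obtain ⟨δ, hδ, H⟩ := exists_forall_isFlux_le hT hp hM (half_pos hε)
  refine ⟨δ, hδ, fun ζ ψ g h hg hcost hψ hz a b ha hab hb hlen => ?_⟩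
  have hA : ∀ s ∈ Set.Icc a b, (∀ k, ∫ u in Set.Ioc a s, g k u ≤ ε / 2) ∧
      ∑' k : ℕ, |(k : ℝ) - 2| * ∫ u in Set.Ioc a s, g k u ≤ ε / 2 := fun s hs =>
    H ζ ψ g h hg hcost _ (Ioc_subset_Icc_of_le ha (hs.2.trans hb)) (by
      rw [Real.volume_Ioc]
      exact (ENNReal.ofReal_lt_ofReal_iff hδ).2 (by linarith [hs.2]))
  have hosc : ∀ s ∈ Set.Icc a b, |ψ s - ψ a| ≤ ε / 2 := fun s hs =>
    (hg.abs_psi_sub_le h hp ha hs.1 (hs.2.trans hb)).trans (hA s hs).2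
  refine ⟨(hosc b ⟨hab, le_rfl⟩).trans (half_le_self hε.le), fun k => ?_⟩
  rcases Nat.eq_zero_or_pos k with rfl | hk
  · rw [hz a ⟨ha, hab.trans hb⟩, hz b ⟨ha.trans hab, hb⟩]
    exact (abs_skorokhod_sub_le hψ ha hab hb hosc).trans (by linarith)
  · rw [abs_sub_comm, hg.zeta_sub hk ha hab hb, abs_of_nonneg (hg.setIntegral_nonneg k _)]
    exact ((hA b ⟨hab, le_rfl⟩).1 k).trans (half_le_self hε.le)

end Regularity

section Compactness

variable {T : ℝ}

/-- Arzelà–Ascoli for a prescribed modulus of continuity and starting point. -/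
lemma isCompact_setOf_modulus (hT : 0 ≤ T) (c : ℝ) {δ : ℝ → ℝ} (hδ : ∀ ε, 0 < ε → 0 < δ ε) :
    IsCompact {f : C(Set.Icc 0 T, ℝ) | f ⟨0, le_rfl, hT⟩ = c ∧ ∀ ε, 0 < ε →
      ∀ x y : Set.Icc 0 T, x ≤ y → (y : ℝ) - x < δ ε → |f y - f x| ≤ ε} := by
  set o : Set.Icc 0 T := ⟨0, le_rfl, hT⟩
  set S : Set (Set.Icc 0 T → ℝ) := {f | f o = c ∧ ∀ ε, 0 < ε →
      ∀ x y : Set.Icc 0 T, x ≤ y → (y : ℝ) - x < δ ε → |f y - f x| ≤ ε} with hS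
  have hequi : ∀ x₀ : Set.Icc 0 T, ∀ ε > 0, ∃ η > 0, ∀ x : Set.Icc 0 T, dist x x₀ < η →
      ∀ f ∈ S, dist (f x₀) (f x) < ε := by
    intro x₀ ε hε
    refine ⟨δ (ε / 2), hδ _ (half_pos hε), fun x hx f hf => lt_of_le_of_lt ?_ (half_lt_self hε)⟩
    rw [Subtype.dist_eq, Real.dist_eq, abs_lt] at hx
    rw [Real.dist_eq]
    rcases le_total x x₀ with hle | hle
    · exact hf.2 _ (half_pos hε) x x₀ hle (by linarith)
    · rw [abs_sub_comm]; exact hf.2 _ (half_pos hε) x₀ x hle (by linarith)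
  have hcont : ∀ f ∈ S, Continuous f := fun f hf => by
    refine continuous_iff_continuousAt.2 fun x₀ => Metric.continuousAt_iff.2 fun ε hε => ?_
    obtain ⟨η, hη, H⟩ := hequi x₀ ε hε
    exact ⟨η, hη, fun {x} hx => by rw [dist_comm]; exact H x hx f hf⟩
  have hbdd : ∀ n : ℕ, ∀ f ∈ S, ∀ x : Set.Icc 0 T, (x : ℝ) ≤ n * (δ 1 / 2) → |f x - c| ≤ n := by
    intro n f hf
    have hδ1 := hδ 1 one_pos
    induction n with
    | zero =>
      intro x hx
      have : x = o := Subtype.ext (le_antisymm (by simpa only [Nat.cast_zero, zero_mul] using hx) x.2.1)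
      simp [this, hf.1]
    | succ n ih =>
      intro x hx
      push_cast at hx ⊢
      have hx2 := x.2
      set y : Set.Icc 0 T := ⟨max 0 (x - δ 1 / 2), le_max_left _ _,
        max_le hT (by linarith [hx2.2])⟩
      have h1 : (y : ℝ) ≤ n * (δ 1 / 2) := max_le (by positivity) (by linarith)
      have h2 : y ≤ x := max_le hx2.1 (by linarith)
      have h3 : (x : ℝ) - y < δ 1 := by
        have : (x : ℝ) - δ 1 / 2 ≤ y := le_max_right _ _
        linarith
      have h4 := ih y h1
      have h5 := hf.2 1 one_pos y x h2 h3
      rw [abs_le] at h4 h5 ⊢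
      constructor <;> linarith
  have himage : ContinuousMap.toFun '' {f : C(Set.Icc 0 T, ℝ) | (f : Set.Icc 0 T → ℝ) ∈ S} = S := by
    ext f
    exact ⟨by rintro ⟨f, hf, rfl⟩; exact hf, fun hf => ⟨⟨f, hcont f hf⟩, hf, rfl⟩⟩
  refine ArzelaAscoli.isCompact_of_equicontinuous
    {f : C(Set.Icc 0 T, ℝ) | (f : Set.Icc 0 T → ℝ) ∈ S} ?_ fun x₀ =>
    Metric.equicontinuousAt_iff.2 fun ε hε => ?_
  · rw [himage]
    obtain ⟨n, hn⟩ := exists_nat_ge (T / (δ 1 / 2))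
    rw [div_le_iff₀ (half_pos (hδ 1 one_pos))] at hn
    refine (isCompact_univ_pi fun _ : Set.Icc 0 T => isCompact_Icc (a := c - n)
      (b := c + n)).of_isClosed_subset ?_ fun f hf x _ => ?_
    · simp only [hS, Set.ofPred_and, Set.ofPred_forall]
      refine (isClosed_eq (continuous_apply _) continuous_const).inter ?_
      refine isClosed_iInter fun ε => isClosed_iInter fun _ => isClosed_iInter fun x =>
        isClosed_iInter fun y => isClosed_iInter fun _ => isClosed_iInter fun _ => ?_
      exact isClosed_le (by fun_prop) continuous_const
    · have := abs_le.1 (hbdd n f hf x (x.2.2.trans hn))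
      constructor <;> linarith
  · obtain ⟨η, hη, H⟩ := hequi x₀ ε hε
    exact ⟨η, hη, fun x hx f => H x hx f f.2⟩

end Compactness

section RateFunction

variable {T : ℝ} {p : ℕ → ℝ}

lemma memCT.pathReg (hT : 0 ≤ T) {f : ℕ → C(Set.Icc 0 T, ℝ)} {ψ : ℝ → ℝ}
    (h : memCT T p (fun k => Set.IccExtend hT (f k)) ψ) :
    PathReg p fun k => Set.IccExtend hT (f k) := by
  obtain ⟨-, hψ, -, -, hz, hk⟩ := h
  have hproj : ∀ k s, Set.IccExtend hT (f k) s =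
      Set.IccExtend hT (f k) (Set.projIcc 0 T hT s : ℝ) := fun k s => by
    rw [Set.IccExtend_val]; rfl
  refine ⟨fun k => (f k).continuous.Icc_extend', fun k s => ?_, fun k h1 s => ?_⟩
  · rw [hproj]
    rcases Nat.eq_zero_or_pos k with rfl | h1
    · exact (skorokhod_nonneg hψ (Set.projIcc 0 T hT s).2).trans_eq
        (hz _ (Set.projIcc 0 T hT s).2).symm
    · exact (hk k h1).2.1 _ (Set.projIcc 0 T hT s).2
  · rw [hproj, ← (hk k h1).1]
    exact (hk k h1).2.2.1 ⟨le_rfl, hT⟩ (Set.projIcc 0 T hT s).2 (Set.projIcc 0 T hT s).2.1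

lemma memCT_of_rateI_ne_top {ζ : ℕ → ℝ → ℝ} {ψ : ℝ → ℝ} (h : rateI T p ζ ψ ≠ ⊤) :
    memCT T p ζ ψ := by
  by_contra hn
  exact h (if_neg hn)

lemma exists_isFlux_of_rateI_lt {ζ : ℕ → ℝ → ℝ} {ψ : ℝ → ℝ} (hreg : PathReg p ζ)
    (hp : Summable fun k : ℕ => (k : ℝ) * p k) {X : ℝ≥0∞} (h : rateI T p ζ ψ < X) :
    ∃ g, IsFlux T p ζ ψ g ∧ ∑' k, fluxCost T ζ g k ≤ X := by
  have hmem := memCT_of_rateI_ne_top h.ne_top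
  rw [rateI, if_pos hmem] at h
  simp_rw [iInf_lt_iff] at h
  obtain ⟨φ, hφ, hlt⟩ := h
  obtain ⟨g, hg, hle⟩ := exists_isFlux_of_memST hreg hp hφ
  exact ⟨g, hg, hle.trans hlt.le⟩

lemma IsFlux.rateI_le {ζ : ℕ → ℝ → ℝ} {ψ : ℝ → ℝ} {g : ℕ → ℝ → ℝ} (hreg : PathReg p ζ)
    (hp : Summable fun k : ℕ => (k : ℝ) * p k) (hg : IsFlux T p ζ ψ g)
    (hmem : memCT T p ζ ψ) : rateI T p ζ ψ ≤ ∑' k, fluxCost T ζ g k := by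
  obtain ⟨φ, hφ, hle⟩ := hg.exists_memST hreg hp
  rw [rateI, if_pos hmem]
  exact (iInf₂_le φ hφ).trans hle

/-- The sub-level set `{I_T ≤ M}`. -/
def rateSublevel (hT : 0 ≤ T) (p : ℕ → ℝ) (M : ℝ) :
    Set ((ℕ → C(Set.Icc (0 : ℝ) T, ℝ)) × C(Set.Icc (0 : ℝ) T, ℝ)) :=
  {q | rateI T p (fun k => Set.IccExtend hT (q.1 k)) (Set.IccExtend hT q.2) ≤ ENNReal.ofReal M}

lemma exists_isFlux_of_mem_rateSublevel {hT : 0 ≤ T}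
    (hp : Summable fun k : ℕ => (k : ℝ) * p k) {M M' : ℝ} (hM : 0 ≤ M) (hMM : M < M')
    {q : (ℕ → C(Set.Icc (0 : ℝ) T, ℝ)) × C(Set.Icc (0 : ℝ) T, ℝ)}
    (hq : q ∈ rateSublevel hT p M) :
    ∃ g, IsFlux T p (fun k => Set.IccExtend hT (q.1 k)) (Set.IccExtend hT q.2) g ∧
      ∑' k, fluxCost T (fun k => Set.IccExtend hT (q.1 k)) g k ≤ ENNReal.ofReal M' := by
  refine exists_isFlux_of_rateI_lt ?_ hp (lt_of_le_of_lt hq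
    ((ENNReal.ofReal_lt_ofReal_iff (hM.trans_lt hMM)).2 hMM))
  exact (memCT_of_rateI_ne_top (ne_top_of_le_ne_top ENNReal.ofReal_ne_top hq)).pathReg hT

lemma memCT_of_mem_rateSublevel {hT : 0 ≤ T} {M : ℝ}
    {q : (ℕ → C(Set.Icc (0 : ℝ) T, ℝ)) × C(Set.Icc (0 : ℝ) T, ℝ)}
    (hq : q ∈ rateSublevel hT p M) :
    memCT T p (fun k => Set.IccExtend hT (q.1 k)) (Set.IccExtend hT q.2) :=
  memCT_of_rateI_ne_top (ne_top_of_le_ne_top ENNReal.ofReal_ne_top hq)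

lemma isClosed_rateSublevel (hT : 0 < T) (hp : Summable fun k : ℕ => (k : ℝ) * p k) {M : ℝ}
    (hM : 0 ≤ M) : IsClosed (rateSublevel hT.le p M) := by
  refine IsSeqClosed.isClosed fun q q' hq hlim => ?_
  rw [Prod.tendsto_iff, tendsto_pi_nhds] at hlim
  set ζ : ℕ → ℝ → ℝ := fun k => Set.IccExtend hT.le (q'.1 k)
  set ψ : ℝ → ℝ := Set.IccExtend hT.le q'.2
  set ζs : ℕ → ℕ → ℝ → ℝ := fun n k => Set.IccExtend hT.le ((q n).1 k)
  set ψs : ℕ → ℝ → ℝ := fun n => Set.IccExtend hT.le (q n).2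
  have hζ : ∀ k s, Tendsto (fun n => ζs n k s) atTop (𝓝 (ζ k s)) := fun k s =>
    ((continuous_eval_const (Set.projIcc 0 T hT.le s)).tendsto _).comp (hlim.1 k)
  have hψ : ∀ s, Tendsto (fun n => ψs n s) atTop (𝓝 (ψ s)) := fun s =>
    ((continuous_eval_const (Set.projIcc 0 T hT.le s)).tendsto _).comp hlim.2
  have hmem : ∀ n, memCT T p (ζs n) (ψs n) := fun n => memCT_of_mem_rateSublevel (hq n)
  have hs : ∀ n, PathReg p (ζs n) := fun n => (hmem n).pathReg hT.le
  have hreg : PathReg p ζ := ⟨fun k => (q'.1 k).continuous.Icc_extend',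
    fun k s => ge_of_tendsto' (hζ k s) fun n => (hs n).nonneg k s,
    fun k hk s => le_of_tendsto' (hζ k s) fun n => (hs n).le k hk s⟩
  have hψc : Continuous ψ := q'.2.continuous.Icc_extend'
  have hψsc : ∀ n, ContinuousOn (ψs n) (Set.Icc 0 T) := fun n => (hmem n).2.1
  have hz : ∀ n, ∀ t ∈ Set.Icc 0 T, ζs n 0 t = skorokhod (ψs n) t := fun n => (hmem n).2.2.2.2.1
  have hflux : ∀ M', M < M' → ∃ g, IsFlux T p ζ ψ g ∧
      ∑' k, fluxCost T ζ g k ≤ ENNReal.ofReal M' := fun M' hMM => by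
    choose gs hgs hcost using fun n => exists_isFlux_of_mem_rateSublevel hp hM hMM (hq n)
    exact exists_isFlux_of_tendsto hT (hM.trans hMM.le) hreg hp hs hgs hcost hψsc hz hζ
      fun t _ => hψ t
  have hzlim : ∀ t ∈ Set.Icc 0 T, ζ 0 t = skorokhod ψ t := fun t ht => by
    refine tendsto_nhds_unique (hζ 0 t) ?_
    simp_rw [hz _ t ht]
    rw [tendsto_iff_dist_tendsto_zero]
    have hd : Tendsto (fun n => 2 * dist (q n).2 q'.2) atTop (𝓝 0) := by
      simpa using (tendsto_iff_dist_tendsto_zero.1 hlim.2).const_mul 2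
    refine squeeze_zero (fun _ => dist_nonneg) (fun n => ?_) hd
    exact abs_skorokhod_sub_skorokhod_le (hψsc n) hψc.continuousOn ht fun s _ =>
      ContinuousMap.dist_apply_le_dist (f := (q n).2) (g := q'.2) (Set.projIcc 0 T hT.le s)
  have hmemlim : memCT T p ζ ψ := by
    obtain ⟨g, hg, hc⟩ := hflux (M + 1) (lt_add_one M)
    obtain ⟨hacψ, hacζ⟩ := hg.absCont hT.le (by linarith) hreg hp
      fun k => (ENNReal.le_tsum k).trans hc
    refine ⟨fun k => (hreg.cont k).continuousOn, hψc.continuousOn, ?_, hacψ, hzlim, fun k hk =>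
      ⟨?_, fun t _ => hreg.nonneg k t, fun s hs' t ht' hst => ?_, hacζ k hk⟩⟩
    · exact tendsto_nhds_unique (hψ 0) (by simp_rw [fun n => (hmem n).2.2.1, tendsto_const_nhds])
    · exact tendsto_nhds_unique (hζ k 0)
        (by simp_rw [fun n => ((hmem n).2.2.2.2.2 k hk).1, tendsto_const_nhds])
    · exact le_of_tendsto_of_tendsto' (hζ k t) (hζ k s) fun n =>
        ((hmem n).2.2.2.2.2 k hk).2.2.1 hs' ht' hst
  refine ENNReal.le_of_forall_pos_le_add fun ε hε _ => ?_
  obtain ⟨g, hg, hc⟩ := hflux (M + ε) (lt_add_of_pos_right M hε)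
  refine (hg.rateI_le hreg hp hmemlim).trans (hc.trans (le_of_eq ?_))
  rw [ENNReal.ofReal_add hM ε.coe_nonneg, ENNReal.ofReal_coe_nnreal]

lemma isCompact_rateSublevel (hT : 0 < T) (hp : Summable fun k : ℕ => (k : ℝ) * p k) {M : ℝ}
    (hM : 0 ≤ M) : IsCompact (rateSublevel hT.le p M) := by
  choose! δ hδ H using fun ε (hε : 0 < ε) =>
    exists_forall_isFlux_abs_sub_le hT.le hp (M := M + 1) (by linarith) hε
  set c : ℕ → ℝ := fun k => if k = 0 then 0 else p k with hc
  refine ((isCompact_univ_pi fun k => isCompact_setOf_modulus hT.le (c k) hδ).prod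
    (isCompact_setOf_modulus hT.le 0 hδ)).of_isClosed_subset (isClosed_rateSublevel hT hp hM) ?_
  intro q hq
  have hmem := memCT_of_mem_rateSublevel hq
  obtain ⟨g, hg, hcost⟩ := exists_isFlux_of_mem_rateSublevel hp hM (lt_add_one M) hq
  have hosc := fun ε hε => H ε hε _ _ g (hmem.pathReg hT.le) hg
    (fun k => (ENNReal.le_tsum k).trans hcost) hmem.2.1 hmem.2.2.2.2.1
  have h0 : (0 : ℝ) ∈ Set.Icc 0 T := ⟨le_rfl, hT.le⟩
  have hψ0 := hmem.2.2.1
  refine ⟨fun k _ => ⟨?_, fun ε hε x y hxy hlen => ?_⟩, ?_, fun ε hε x y hxy hlen => ?_⟩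
  · rcases Nat.eq_zero_or_pos k with rfl | hk
    · have h1 := hmem.2.2.2.2.1 0 h0
      simp only [skorokhod, Set.Icc_self, Set.image_singleton, csInf_singleton, hψ0, min_self,
        sub_zero] at h1
      rwa [Set.IccExtend_of_mem hT.le _ h0] at h1
    · have h1 := (hmem.2.2.2.2.2 k hk).1
      beta_reduce at h1
      rw [Set.IccExtend_of_mem hT.le _ h0] at h1
      rw [h1, hc]
      exact (if_neg hk.ne').symm
  · simpa only [Set.IccExtend_val] using (hosc ε hε x y x.2.1 hxy y.2.2 hlen).2 k
  · rwa [Set.IccExtend_of_mem hT.le _ h0] at hψ0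
  · simpa only [Set.IccExtend_val] using (hosc ε hε x y x.2.1 hxy y.2.2 hlen).1

end RateFunction

lemma summable_natCast_mul_of_rpow {p : ℕ → ℝ} (hpnn : ∀ k, 0 ≤ p k)
    (hmom : ∃ ε : ℝ, 0 < ε ∧ Summable fun k : ℕ => p k * (k : ℝ) ^ ((1 : ℝ) + ε)) :
    Summable fun k : ℕ => (k : ℝ) * p k := by
  obtain ⟨ε, hε, hsum⟩ := hmom
  refine Summable.of_nonneg_of_le (fun k => mul_nonneg k.cast_nonneg (hpnn k)) (fun k => ?_) hsum
  rw [mul_comm]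
  refine mul_le_mul_of_nonneg_left ?_ (hpnn k)
  rcases Nat.eq_zero_or_pos k with rfl | hk
  · simpa using Real.rpow_nonneg le_rfl _
  · exact Real.self_le_rpow_of_one_le (by exact_mod_cast hk) (by linarith)

/-- Compactness of sub-level sets of the rate function `I_T`, viewed as a function on
`C([0,T], ℝ^∞) × C([0,T], ℝ)` (with the uniform/product topology); elements of the
function space are extended to all of `ℝ` by clamping (`Set.IccExtend`), which does not
change their values on `[0,T]`. -/
theorem sublevel_sets_compact (T : ℝ) (hT : 0 < T)
    (p : ℕ → ℝ) (hp0 : p 0 = 0) (hpnn : ∀ k, 0 ≤ p k) (hp1 : ∑' k : ℕ, p k = 1)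
    (hmom : ∃ ε : ℝ, 0 < ε ∧ Summable fun k : ℕ => p k * (k : ℝ) ^ ((1 : ℝ) + ε))
    (M : ℝ) (hM : 0 ≤ M) :
    IsCompact {q : (ℕ → C(Set.Icc (0 : ℝ) T, ℝ)) × C(Set.Icc (0 : ℝ) T, ℝ) |
      rateI T p (fun k => Set.IccExtend hT.le (q.1 k)) (Set.IccExtend hT.le q.2)
        ≤ ENNReal.ofReal M} := by
  exact isCompact_rateSublevel hT (summable_natCast_mul_of_rpow hpnn hmom) hM
end

section
/- Let p = (p_k)_{k≥1} be nonnegative reals with ∑_{k≥1} k²·p_k < ∞, and fix T > 0. Suppose for i = 1, 2 that ζ̃^{(i)}_k : [0,T] → ℝ (k ≥ 1) are continuous and ψ̃^{(i)} ∈ C([0,T], ℝ) satisfy, for all t ∈ [0,T]: ζ̃^{(i)}_k(t) = p_k − ∫_0^t k·ζ̃^{(i)}_k(s) ds for every k ≥ 1, and ψ̃^{(i)}(t) = ∑_{k≥1} (k−2)·∫_0^t k·ζ̃^{(i)}_k(s) ds − 2·∫_0^t Γ(ψ̃^{(i)})(s) ds. Then ζ̃^{(1)}_k = ζ̃^{(2)}_k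 for every k ≥ 1 and ψ̃^{(1)} = ψ̃^{(2)}. -/
open MeasureTheory Filter Topology

/-- Grönwall-type uniqueness for causal functional integral equations. -/
theorem eq_zero_of_eq_integral_of_causal_bound {T K : ℝ} (hK : 0 ≤ K) {d F : ℝ → ℝ}
    (hd : ContinuousOn d (Set.Icc 0 T))
    (hdF : ∀ t ∈ Set.Icc 0 T, d t = ∫ s in (0 : ℝ)..t, F s)
    (hF : ∀ t ∈ Set.Icc 0 T, ∀ B : ℝ, (∀ s ∈ Set.Icc 0 t, |d s| ≤ B) → |F t| ≤ K * B) :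
    ∀ t ∈ Set.Icc 0 T, d t = 0 := by
  obtain ⟨M, hM⟩ := isCompact_Icc.exists_bound_of_continuousOn hd
  have key : ∀ n : ℕ, ∀ t ∈ Set.Icc 0 T, |d t| ≤ |M| * ((K * t) ^ n / n.factorial) := by
    intro n
    induction n with
    | zero =>
      intro t ht
      simpa using (hM t ht).trans (le_abs_self M)
    | succ n ih =>
      intro t ht
      have hbound : ∀ s ∈ Set.Ioc 0 t,
          ‖F s‖ ≤ K * (|M| * ((K * s) ^ n / n.factorial)) := by
        intro s hs
        refine hF s ⟨hs.1.le, hs.2.trans ht.2⟩ _ fun u hu => ?_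
        refine (ih u ⟨hu.1, hu.2.trans (hs.2.trans ht.2)⟩).trans ?_
        have h0 : 0 ≤ u := hu.1
        have h1 : u ≤ s := hu.2
        gcongr
      have hint : ∫ s in (0 : ℝ)..t, K * (|M| * ((K * s) ^ n / n.factorial))
          = |M| * ((K * t) ^ (n + 1) / (n + 1).factorial) := by
        have hfun : (fun s : ℝ => K * (|M| * ((K * s) ^ n / n.factorial)))
            = fun s : ℝ => (K * |M| * K ^ n / n.factorial) * s ^ n := by
          funext s
          rw [mul_pow]
          ring
        rw [hfun, intervalIntegral.integral_const_mul, integral_pow, Nat.factorial_succ]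
        have := Nat.factorial_ne_zero n
        push_cast
        field_simp
        rw [zero_pow n.succ_ne_zero]
        ring
      rw [hdF t ht, ← hint]
      refine intervalIntegral.norm_integral_le_of_norm_le ht.1 (ae_of_all _ hbound) ?_
      exact Continuous.intervalIntegrable (by fun_prop) _ _
  intro t ht
  have hlim := (FloorSemiring.tendsto_pow_div_factorial_atTop (K * t)).const_mul |M|
  rw [mul_zero] at hlim
  exact abs_nonpos_iff.1 (ge_of_tendsto' hlim fun n => key n t ht)

theorem sInf_image_le_sInf_image_add {α : Type*} {s : Set α} (hs : s.Nonempty) {f g : α → ℝ}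
    {B : ℝ} (hf : BddBelow (f '' s)) (h : ∀ x ∈ s, |f x - g x| ≤ B) :
    sInf (f '' s) ≤ sInf (g '' s) + B := by
  rw [← sub_le_iff_le_add]
  refine le_csInf (hs.image g) ?_
  rintro _ ⟨x, hx, rfl⟩
  have := csInf_le hf (Set.mem_image_of_mem f hx)
  have := (abs_le.1 (h x hx)).2
  linarith

/-- The Skorokhod map is `2`-Lipschitz with respect to the supremum norm. -/
theorem abs_skorokhod_sub_skorokhod_le_s18 {f g : ℝ → ℝ} {t B : ℝ} (ht : 0 ≤ t)
    (hf : ContinuousOn f (Set.Icc 0 t)) (hg : ContinuousOn g (Set.Icc 0 t))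
    (h : ∀ s ∈ Set.Icc 0 t, |f s - g s| ≤ B) :
    |skorokhod f t - skorokhod g t| ≤ 2 * B := by
  have hne : (Set.Icc 0 t).Nonempty := Set.nonempty_Icc.2 ht
  have h1 := sInf_image_le_sInf_image_add hne (isCompact_Icc.bddBelow_image hf) h
  have h2 := sInf_image_le_sInf_image_add hne (isCompact_Icc.bddBelow_image hg)
    fun s hs => abs_sub_comm (f s) (g s) ▸ h s hs
  have ht' := h t ⟨ht, le_rfl⟩
  have hB : 0 ≤ B := (abs_nonneg _).trans ht'
  have hmin : |min (sInf (f '' Set.Icc 0 t)) 0 - min (sInf (g '' Set.Icc 0 t)) 0| ≤ B := by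
    refine (abs_min_sub_min_le_max _ _ _ _).trans (max_le ?_ (by simpa using hB))
    rw [abs_le]
    constructor <;> linarith
  unfold skorokhod
  rw [abs_le] at *
  constructor <;> linarith

theorem intervalIntegrable_skorokhod {f : ℝ → ℝ} {t : ℝ} (ht : 0 ≤ t)
    (hf : ContinuousOn f (Set.Icc 0 t)) :
    IntervalIntegrable (skorokhod f) volume 0 t := by
  have hanti : AntitoneOn (fun s => min (sInf (f '' Set.Icc 0 s)) 0) (Set.Icc 0 t) := by
    intro a ha b hb hab
    refine min_le_min_right _ (csInf_le_csInf ?_ ((Set.nonempty_Icc.2 ha.1).image f) ?_)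
    · exact isCompact_Icc.bddBelow_image (hf.mono (Set.Icc_subset_Icc_right hb.2))
    · exact Set.image_mono (Set.Icc_subset_Icc_right hab)
  rw [← Set.uIcc_of_le ht] at hf hanti
  exact hf.intervalIntegrable.sub hanti.intervalIntegrable

/-- Uniqueness for the time-changed system of ODEs
`ζ̃_k(t) = p_k − ∫₀ᵗ k ζ̃_k(s) ds` (k ≥ 1) and
`ψ̃(t) = ∑_{k≥1} (k−2) ∫₀ᵗ k ζ̃_k(s) ds − 2 ∫₀ᵗ Γ(ψ̃)(s) ds`. -/
theorem time_changed_ode_uniqueness (T : ℝ) (hT : 0 < T)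
    (p : ℕ → ℝ) (hpnn : ∀ k, 0 ≤ p k)
    (hmom2 : Summable fun k : ℕ => (k : ℝ) ^ 2 * p k)
    (ζ₁ ζ₂ : ℕ → ℝ → ℝ) (ψ₁ ψ₂ : ℝ → ℝ)
    (hζ₁cont : ∀ k : ℕ, 1 ≤ k → ContinuousOn (ζ₁ k) (Set.Icc 0 T))
    (hζ₂cont : ∀ k : ℕ, 1 ≤ k → ContinuousOn (ζ₂ k) (Set.Icc 0 T))
    (hψ₁cont : ContinuousOn ψ₁ (Set.Icc 0 T))
    (hψ₂cont : ContinuousOn ψ₂ (Set.Icc 0 T))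
    (hζ₁ : ∀ t ∈ Set.Icc (0 : ℝ) T, ∀ k : ℕ, 1 ≤ k →
      ζ₁ k t = p k - ∫ s in (0 : ℝ)..t, (k : ℝ) * ζ₁ k s)
    (hζ₂ : ∀ t ∈ Set.Icc (0 : ℝ) T, ∀ k : ℕ, 1 ≤ k →
      ζ₂ k t = p k - ∫ s in (0 : ℝ)..t, (k : ℝ) * ζ₂ k s)
    (hψ₁ : ∀ t ∈ Set.Icc (0 : ℝ) T,
      ψ₁ t = (∑' k : ℕ, ((k : ℝ) - 2) * ∫ s in (0 : ℝ)..t, (k : ℝ) * ζ₁ k s)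
        - 2 * ∫ s in (0 : ℝ)..t, skorokhod ψ₁ s)
    (hψ₂ : ∀ t ∈ Set.Icc (0 : ℝ) T,
      ψ₂ t = (∑' k : ℕ, ((k : ℝ) - 2) * ∫ s in (0 : ℝ)..t, (k : ℝ) * ζ₂ k s)
        - 2 * ∫ s in (0 : ℝ)..t, skorokhod ψ₂ s) :
    (∀ k : ℕ, 1 ≤ k → ∀ t ∈ Set.Icc (0 : ℝ) T, ζ₁ k t = ζ₂ k t) ∧
    (∀ t ∈ Set.Icc (0 : ℝ) T, ψ₁ t = ψ₂ t) := by
  have hζ : ∀ k : ℕ, 1 ≤ k → ∀ t ∈ Set.Icc (0 : ℝ) T, ζ₁ k t = ζ₂ k t := by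
    intro k hk t ht
    refine sub_eq_zero.1 (eq_zero_of_eq_integral_of_causal_bound (K := k)
      (d := fun t => ζ₁ k t - ζ₂ k t) (F := fun s => (k : ℝ) * ζ₂ k s - (k : ℝ) * ζ₁ k s)
      k.cast_nonneg ((hζ₁cont k hk).sub (hζ₂cont k hk)) ?_ ?_ t ht)
    · intro t ht
      have hsub : Set.uIcc 0 t ⊆ Set.Icc 0 T := by
        rw [Set.uIcc_of_le ht.1]
        exact Set.Icc_subset_Icc_right ht.2
      rw [intervalIntegral.integral_sub, hζ₁ t ht k hk, hζ₂ t ht k hk]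
      · ring
      · exact (((hζ₂cont k hk).mono hsub).const_mul _).intervalIntegrable
      · exact (((hζ₁cont k hk).mono hsub).const_mul _).intervalIntegrable
    · intro t ht B hB
      rw [← mul_sub, abs_mul, Nat.abs_cast, abs_sub_comm]
      exact mul_le_mul_of_nonneg_left (hB t ⟨ht.1, le_rfl⟩) k.cast_nonneg
  refine ⟨hζ, fun t ht => ?_⟩
  have hmono {t : ℝ} (ht : t ∈ Set.Icc 0 T) : Set.Icc 0 t ⊆ Set.Icc 0 T :=
    Set.Icc_subset_Icc_right ht.2
  refine sub_eq_zero.1 (eq_zero_of_eq_integral_of_causal_bound (K := 4)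
    (d := fun t => ψ₁ t - ψ₂ t) (F := fun s => 2 * (skorokhod ψ₂ s - skorokhod ψ₁ s))
    (by norm_num) (hψ₁cont.sub hψ₂cont) ?_ ?_ t ht)
  · intro t ht
    have hseries : ∀ k : ℕ, ∫ s in (0 : ℝ)..t, (k : ℝ) * ζ₁ k s
        = ∫ s in (0 : ℝ)..t, (k : ℝ) * ζ₂ k s := by
      intro k
      refine intervalIntegral.integral_congr fun s hs => ?_
      rw [Set.uIcc_of_le ht.1] at hs
      rcases k.eq_zero_or_pos with rfl | hk
      · simp
      · simp only [hζ k hk s (hmono ht hs)]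
    rw [intervalIntegral.integral_const_mul, intervalIntegral.integral_sub
      (intervalIntegrable_skorokhod ht.1 (hψ₂cont.mono (hmono ht)))
      (intervalIntegrable_skorokhod ht.1 (hψ₁cont.mono (hmono ht))), hψ₁ t ht, hψ₂ t ht]
    simp only [hseries]
    ring
  · intro t ht B hB
    have := abs_skorokhod_sub_skorokhod_le_s18 ht.1 (hψ₁cont.mono (hmono ht))
      (hψ₂cont.mono (hmono ht)) hB
    rw [abs_mul, abs_two, abs_sub_comm]
    linarith
end
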